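/- Let (𝔊,Φ) be a structurally compatible affine cellular automaton of radius 1 on an irreducible topological Markov chain 𝔊 whose topological entropy satisfies h(𝔊) = log p for a prime number p. Let μ be a Borel probability measure on 𝔊 invariant under both Φ and the shift σ, and suppose: (i) μ is ergodic for the ℤ²-action generated by Φ and σ (every Borel set invariant under both Φ and σ has μ-measure 0 or 1); (ii) the Kolmogorov–Sinai entropy h_μ(Φ) is positive; (iii) the σ-algebra of σ^{(p−1)p}-invariant Borel sets coincides modulo μ-null sets with the σ-algebra of σ-invariant Borel sets. Then μ is the Parry measure of 𝔊. -/

import Mathlib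

open Filter Topology MeasureTheory
open scoped ENNReal

namespace CAStmt

/-- The shift map on bi-infinite sequences. -/
def shiftMap {G : Type*} (x : ℤ → G) : ℤ → G := fun n => x (n + 1)

/-- The topological Markov chain determined by the transition set `E`. -/
def TMC {G : Type*} (E : Set (G × G)) : Set (ℤ → G) := {x | ∀ i : ℤ, (x i, x (i + 1)) ∈ E}

/-- The word `w` occurs in some point of `X`. -/
def WordIn {G : Type*} (X : Set (ℤ → G)) {m : ℕ} (w : Fin m → G) : Prop :=
  ∃ x ∈ X, ∃ j : ℤ, ∀ i : Fin m, x (j + ((i : ℕ) : ℤ)) = w i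

/-- Every letter of the alphabet occurs in some point of the TMC. -/
def EveryLetterOccurs {G : Type*} (E : Set (G × G)) : Prop :=
  ∀ g : G, ∃ x ∈ TMC E, ∃ i : ℤ, x i = g

/-- The radius-1 cellular automaton map with local rule `φ`. -/
def CA {G : Type*} (φ : G → G → G) (x : ℤ → G) : ℤ → G := fun j => φ (x j) (x (j + 1))

/-- Structural compatibility of the local rule `φ` with the TMC of `E`. -/
def SC {G : Type*} (E : Set (G × G)) (φ : G → G → G) : Prop :=
  ∀ x ∈ TMC E, ∀ y ∈ TMC E, (fun i => φ (x i) (y i)) ∈ TMC E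

def RightPerm {G : Type*} (φ : G → G → G) : Prop := ∀ a, Function.Bijective (φ a)

def LeftPerm {G : Type*} (φ : G → G → G) : Prop := ∀ b, Function.Bijective (fun a => φ a b)

/-- Irreducibility: any two letters are joined by an allowed word `(u,v₁,…,v_k,w)`, `k ≥ 1`. -/
def IrreducibleTMC {G : Type*} (E : Set (G × G)) : Prop :=
  ∀ u w : G, ∃ x ∈ TMC E, ∃ i j : ℤ, i + 1 < j ∧ x i = u ∧ x j = w

/-- Mixing with mixing constant `q`. -/
def MixingTMCWith {G : Type*} (E : Set (G × G)) (q : ℕ) : Prop :=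
  1 ≤ q ∧ ∀ k : ℕ, q ≤ k → ∀ u w : G,
    ∃ x ∈ TMC E, ∃ i : ℤ, x i = u ∧ x (i + (k : ℤ) + 1) = w

def MixingTMC {G : Type*} (E : Set (G × G)) : Prop := ∃ q, MixingTMCWith E q

/-- `Φ` is `N`-scaling on `X`: `(Φ^N x)₀ = φ(x₀, x_N)`. -/
def NScalingOn {G : Type*} (X : Set (ℤ → G)) (φ : G → G → G) (N : ℕ) : Prop :=
  ∀ x ∈ X, (CA φ)^[N] x 0 = φ (x 0) (x (N : ℤ))

/-- The TMC `𝔥(𝔽,τ,n)` over the alphabet `F × Fin n`. -/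
def hTMC {F : Type*} (τ : Equiv.Perm F) (n : ℕ) : Set (ℤ → F × Fin n) :=
  TMC {p : (F × Fin n) × (F × Fin n) | p.2.1 = τ p.1.1}

/-- `op` is a `k`-block operation (memory 0, anticipation `k-1`) closed on `Λ`. -/
def KBlockOp {A : Type*} (Λ : Set (ℤ → A)) (k : ℕ)
    (op : (ℤ → A) → (ℤ → A) → (ℤ → A)) : Prop :=
  (∀ x ∈ Λ, ∀ y ∈ Λ, op x y ∈ Λ) ∧
  ∃ ρ : (Fin k → A) → (Fin k → A) → A,
    ∀ x ∈ Λ, ∀ y ∈ Λ, ∀ j : ℤ,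
      op x y j = ρ (fun i => x (j + ((i : ℕ) : ℤ))) (fun i => y (j + ((i : ℕ) : ℤ)))

/-- `op` is a quasigroup operation on `Λ`: all translations are bijections of `Λ`. -/
def QuasigroupOp {A : Type*} (Λ : Set (ℤ → A)) (op : (ℤ → A) → (ℤ → A) → (ℤ → A)) : Prop :=
  ∀ z ∈ Λ, Set.BijOn (fun x => op x z) Λ Λ ∧ Set.BijOn (fun y => op z y) Λ Λ

/-- A 1-block topological conjugacy between `(X,Φ)` and `(Y,Ψ)` induced by the letter map `θ`. -/
def OneBlockConjugacy {A B : Type*} (X : Set (ℤ → A)) (Φ : (ℤ → A) → (ℤ → A))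
    (Y : Set (ℤ → B)) (Ψ : (ℤ → B) → (ℤ → B)) (θ : A → B) : Prop :=
  Set.BijOn (fun x => θ ∘ x) X Y ∧ ∀ x ∈ X, θ ∘ (Φ x) = Ψ (θ ∘ x)

/-- `add` is an abelian group operation. -/
def IsAbelianGroupOp {K : Type*} (add : K → K → K) : Prop :=
  (∀ a b c, add (add a b) c = add a (add b c)) ∧ (∀ a b, add a b = add b a) ∧
  ∃ z : K, (∀ a, add z a = a) ∧ ∀ a, ∃ b, add a b = z

/-- The product transition set on `K × B`. -/
def prodE {K B : Type*} (EK : Set (K × K)) (EB : Set (B × B)) : Set ((K × B) × (K × B)) :=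
  {p | (p.1.1, p.2.1) ∈ EK ∧ (p.1.2, p.2.2) ∈ EB}

/-- `φK` is an affine local rule for the abelian group operation `add`. -/
def IsAffineRuleExpl {K : Type*} (add : K → K → K) (φK : K → K → K) : Prop :=
  IsAbelianGroupOp add ∧
  ∃ (η ρc : K → K) (c : K), Function.Bijective η ∧ Function.Bijective ρc ∧
    (∀ a b, η (add a b) = add (η a) (η b)) ∧ (∀ a b, ρc (add a b) = add (ρc a) (ρc b)) ∧
    (∀ a, η (ρc a) = ρc (η a)) ∧
    ∀ a b, φK a b = add (add (η a) (ρc b)) c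

/-- The cylinder on the word `w` at coordinates `0,…,m-1`. -/
def cyl {A : Type*} {m : ℕ} (w : Fin m → A) : Set (ℤ → A) :=
  {x | ∀ i : Fin m, x ((i : ℕ) : ℤ) = w i}

/-- A past: `p i` is the letter at coordinate `-(i+1)`; all transitions allowed. -/
def IsPast {A : Type*} (E : Set (A × A)) (p : ℕ → A) : Prop :=
  ∀ i : ℕ, (p (i + 1), p i) ∈ E

/-- The word `(w_{-m},…,w_{-1})` of the past `p`. -/
def pastWord {A : Type*} (p : ℕ → A) (m : ℕ) : Fin m → A :=
  fun j => p (m - 1 - (j : ℕ))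

/-- `μ` has complete connections (compatible with the TMC of `E`) and summable decay. -/
def CCSD {A : Type*} [MeasurableSpace A] (E : Set (A × A)) (μ : Measure (ℤ → A)) : Prop :=
  ∃ ν : (ℕ → A) → A → ℝ,
    (∀ p, IsPast E p → ∀ a, (p 0, a) ∈ E →
      0 < ν p a ∧
      Tendsto (fun m : ℕ =>
          (μ (cyl (Fin.snoc (pastWord p m) a))).toReal / (μ (cyl (pastWord p m))).toReal)
        atTop (nhds (ν p a))) ∧
    ∃ γ : ℕ → ℝ, Summable γ ∧
      ∀ m : ℕ, 1 ≤ m → ∀ p q, IsPast E p → IsPast E q → (∀ i < m, p i = q i) →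
        ∀ a, (p 0, a) ∈ E → |ν p a / ν q a - 1| ≤ γ m

/-- A shift-invariant probability measure carried by the TMC of `E`, positive on allowed
cylinders. -/
def GoodMeasure {A : Type*} [MeasurableSpace A] (E : Set (A × A)) (μ : Measure (ℤ → A)) : Prop :=
  IsProbabilityMeasure μ ∧ Measure.map shiftMap μ = μ ∧ μ (TMC E) = 1 ∧
  ∀ (m : ℕ) (w : Fin m → A), WordIn (TMC E) w → 0 < μ (cyl w)

/-- The identification of `𝔽 × Σ_n` with `𝔥(𝔽,τ,n)`. -/
def ident {F : Type*} (τ : Equiv.Perm F) {n : ℕ} (f : F) (y : ℤ → Fin n) : ℤ → F × Fin n :=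
  fun i => ((τ ^ i) f, y i)

/-- A quasigroup operation on an alphabet. -/
def QuasigroupPointOp {K : Type*} (o : K → K → K) : Prop :=
  ∀ a, Function.Bijective (fun x => o x a) ∧ Function.Bijective (o a)

/-- The data witnessing that an SC bipermutative c.a. is regular and simple. -/
def RegularSimpleData {K F : Type*} (EK : Set (K × K)) (φK : K → K → K)
    (τ : Equiv.Perm F) (n k : ℕ)
    (op : (ℤ → F × Fin n) → (ℤ → F × Fin n) → (ℤ → F × Fin n))
    (θ : K → F × Fin n) (oF : F → F → F) (oS : Fin n → Fin n → Fin n) : Prop :=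
  1 ≤ n ∧ 1 ≤ k ∧
  KBlockOp (hTMC τ n) k op ∧ QuasigroupOp (hTMC τ n) op ∧
  OneBlockConjugacy (TMC EK) (CA φK) (hTMC τ n) (fun x => op x (shiftMap x)) θ ∧
  QuasigroupPointOp oF ∧ QuasigroupPointOp oS ∧
  ∀ (f g : F) (y z : ℤ → Fin n),
    op (ident τ f y) (ident τ g z) = ident τ (oF f g) (fun i => oS (y i) (z i))

/-- An SC bipermutative c.a. is regular and simple. -/
def RegularSimple {K : Type*} (EK : Set (K × K)) (φK : K → K → K) : Prop :=
  ∃ (F : Type) (_ : Fintype F) (τ : Equiv.Perm F) (n k : ℕ)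
    (op : (ℤ → F × Fin n) → (ℤ → F × Fin n) → (ℤ → F × Fin n))
    (θ : K → F × Fin n) (oF : F → F → F) (oS : Fin n → Fin n → Fin n),
    RegularSimpleData EK φK τ n k op θ oF oS

/-- Weak-* convergence of the Cesàro means of `μ` under `Φ` to `κ`. -/
def CesaroTendstoTo {G : Type*} [TopologicalSpace G] [MeasurableSpace G]
    (μ : Measure (ℤ → G)) (Φ : (ℤ → G) → (ℤ → G)) (κ : Measure (ℤ → G)) : Prop :=
  ∀ f : C(ℤ → G, ℝ), Tendsto
    (fun N : ℕ => (N : ℝ)⁻¹ * ∑ n ∈ Finset.range N, ∫ x, f (Φ^[n] x) ∂μ)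
    atTop (nhds (∫ x, f x ∂κ))

/-- `κ` is the Parry measure of the irreducible TMC of `E`. -/
def IsParryMeasure {G : Type*} [Fintype G] [MeasurableSpace G] (E : Set (G × G))
    (κ : Measure (ℤ → G)) : Prop :=
  IsProbabilityMeasure κ ∧ Measure.map shiftMap κ = κ ∧
  ∃ (lam : ℝ) (r l : G → ℝ), 0 < lam ∧ (∀ a, 0 < r a) ∧ (∀ a, 0 < l a) ∧
    (∀ a : G, (∑ b : G, E.indicator (fun _ => r b) (a, b)) = lam * r a) ∧
    (∀ b : G, (∑ a : G, E.indicator (fun _ => l a) (a, b)) = lam * l b) ∧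
    (∑ a : G, l a * r a) = 1 ∧
    ∀ (m : ℕ) (w : Fin (m + 1) → G), WordIn (TMC E) w →
      (κ (cyl w)).toReal = l (w 0) * r (w (Fin.last m)) / lam ^ m

/-- Entropy of the refinement `P ∨ T⁻¹P ∨ ⋯ ∨ T^{-(n-1)}P`. -/
noncomputable def joinEntropy {X : Type*} [MeasurableSpace X] (μ : Measure X) (T : X → X)
    {r : ℕ} (P : Fin r → Set X) (n : ℕ) : ℝ :=
  -∑ c : Fin n → Fin r,
      ((μ (⋂ i : Fin n, T^[(i : ℕ)] ⁻¹' P (c i))).toReal *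
        Real.log (μ (⋂ i : Fin n, T^[(i : ℕ)] ⁻¹' P (c i))).toReal)

/-- The Kolmogorov–Sinai entropy `h_μ(T)` is positive: some finite measurable partition has
positive entropy. -/
def KSEntropyPos {X : Type*} [MeasurableSpace X] (μ : Measure X) (T : X → X) : Prop :=
  ∃ (r : ℕ) (P : Fin r → Set X), (∀ i, MeasurableSet (P i)) ∧
    Pairwise (Function.onFun Disjoint P) ∧ (⋃ i, P i) = Set.univ ∧
    0 < Filter.liminf (fun n : ℕ => joinEntropy μ T P n / n) Filter.atTop

end CAStmt

namespace CAStmt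

section FullShift

variable {p : ℕ}

/-- The shift on sequences over `ZMod p`, as a linear map. -/
def shiftLin (p : ℕ) : (ℤ → ZMod p) →ₗ[ZMod p] (ℤ → ZMod p) :=
  LinearMap.funLeft (ZMod p) (ZMod p) (fun n : ℤ => n + 1)

/-- The linear cellular automaton `(Lv)_j = a v_j + b v_{j+1}`. -/
def linCA (a b : ZMod p) : (ℤ → ZMod p) →ₗ[ZMod p] (ℤ → ZMod p) :=
  a • LinearMap.id + b • shiftLin p

@[simp] lemma shiftLin_apply (v : ℤ → ZMod p) : shiftLin p v = shiftMap v := rfl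

lemma shiftLin_pow_apply (v : ℤ → ZMod p) (n : ℕ) : (shiftLin p ^ n) v = shiftMap^[n] v := by
  rw [Module.End.coe_pow]; rfl

@[simp] lemma linCA_apply (a b : ZMod p) (v : ℤ → ZMod p) (i : ℤ) :
    linCA a b v i = a * v i + b * v (i + 1) := rfl

lemma iterate_shiftMap_apply {A : Type*} (x : ℤ → A) (n : ℕ) (i : ℤ) :
    shiftMap^[n] x i = x (i + n) := by
  induction n generalizing x with
  | zero => simp
  | succ n ih =>
    rw [Function.iterate_succ_apply, ih]
    simp only [shiftMap]
    congr 1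
    push_cast
    ring

lemma commute_shiftLin_linCA (a b : ZMod p) : Commute (shiftLin p) (linCA a b) := by
  ext v i
  simp [shiftMap]

/-- Bi-infinite orbits of a sequence of permutations. -/
lemma exists_orbit {A : Type*} (e : ℤ → Equiv.Perm A) (s : ℤ) (t : A) :
    ∃ d : ℤ → A, d s = t ∧ ∀ i, d (i + 1) = e i (d i) := by
  refine ⟨fun i => Int.inductionOn' (motive := fun _ => A) i s t (fun k _ x => e k x)
    (fun k _ x => (e (k - 1)).symm x), Int.inductionOn'_self, fun i => ?_⟩
  beta_reduce
  rcases le_or_gt s i with h | h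
  · rw [Int.inductionOn'_add_one h]
  · have h' : i + 1 ≤ s := h
    have := Int.inductionOn'_sub_one (motive := fun _ => A) (zero := t)
      (succ := fun k _ x => e k x) (pred := fun k _ x => (e (k - 1)).symm x) h'
    rw [show i + 1 - 1 = i by ring] at this
    simp only [this, Equiv.apply_symm_apply]

lemma pow_succ_apply_eq (a b : ZMod p) (n : ℕ) (v : ℤ → ZMod p) :
    (linCA a b ^ (n + 1)) v = (linCA a b ^ n) (linCA a b v) := by
  rw [pow_succ]; rfl

lemma pow_succ_apply_eq' (a b : ZMod p) (n : ℕ) (v : ℤ → ZMod p) :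
    (linCA a b ^ (n + 1)) v = linCA a b ((linCA a b ^ n) v) := by
  rw [pow_succ']; rfl

variable [Fact p.Prime] {a b : ZMod p}

lemma exists_linCA_eq (ha : a ≠ 0) (hb : b ≠ 0) (y : ℤ → ZMod p) (s : ℤ) (t : ZMod p) :
    ∃ d, linCA a b d = y ∧ d s = t := by
  obtain ⟨d, hd, hd'⟩ := exists_orbit (fun i =>
    (⟨fun x => b⁻¹ * (y i - a * x), fun x => a⁻¹ * (y i - b * x),
      fun x => by field_simp; ring, fun x => by field_simp; ring⟩ : Equiv.Perm (ZMod p))) s t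
  refine ⟨d, ?_, hd⟩
  ext i
  rw [linCA_apply, hd']
  simp only [Equiv.coe_fn_mk]
  field_simp
  ring

lemma linCA_surjective (ha : a ≠ 0) (hb : b ≠ 0) : Function.Surjective (linCA a b) := fun y =>
  let ⟨d, hd, _⟩ := exists_linCA_eq ha hb y 0 0
  ⟨d, hd⟩

lemma eq_on_window_of_linCA_eq (hb : b ≠ 0) {d d' : ℤ → ZMod p} {s : ℤ} {j : ℕ}
    (hs : d s = d' s)
    (h : ∀ i, s ≤ i → i < s + j → linCA a b d i = linCA a b d' i) :
    ∀ i, s ≤ i → i ≤ s + j → d i = d' i := by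
  intro i hi
  induction i, hi using Int.leInduction with
  | base => intro _; exact hs
  | succ i hi ih =>
    intro hij
    have h1 := ih (by omega)
    have h2 := h i hi (by omega)
    simp only [linCA_apply, h1, add_right_inj] at h2
    exact mul_left_cancel₀ hb h2

lemma eq_zero_of_linCA_eq_zero (ha : a ≠ 0) (hb : b ≠ 0) {d : ℤ → ZMod p}
    (h : linCA a b d = 0) {s : ℤ} (hs : d s = 0) : d = 0 := by
  have h' : ∀ i, a * d i + b * d (i + 1) = 0 := fun i => congrFun h i
  ext i
  induction i using Int.inductionOn' (b := s) with
  | zero => simpa using hs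
  | succ k _ ih =>
    have := h' k
    rw [ih] at this
    simpa [hb] using this
  | pred k _ ih =>
    have := h' (k - 1)
    rw [sub_add_cancel, ih] at this
    simpa [ha] using this

lemma exists_ker_eq_window (ha : a ≠ 0) (hb : b ≠ 0) (j : ℕ) (v : ℤ → ZMod p) (s : ℤ) :
    ∃ d, (linCA a b ^ j) d = 0 ∧ ∀ i, s ≤ i → i < s + j → d i = v i := by
  induction j generalizing v with
  | zero => exact ⟨0, by simp, fun i h h' => by simp at h'; omega⟩
  | succ j ih =>
    obtain ⟨d', hd', hw⟩ := ih (linCA a b v)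
    obtain ⟨d, hd, hs⟩ := exists_linCA_eq ha hb d' s (v s)
    refine ⟨d, by rw [pow_succ_apply_eq, hd, hd'], fun i hi hi' => ?_⟩
    refine eq_on_window_of_linCA_eq (a := a) (j := j) hb hs (fun i hi hi' => ?_) i hi (by
      push_cast at hi'; omega)
    rw [hd, hw i hi hi']

lemma finite_ker_pow (ha : a ≠ 0) (hb : b ≠ 0) (n : ℕ) :
    Finite (LinearMap.ker (linCA a b ^ n)) := by
  induction n with
  | zero =>
    have : LinearMap.ker (linCA a b ^ 0) = ⊥ := by
      rw [pow_zero]; exact LinearMap.ker_id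
    rw [this]; infer_instance
  | succ n ih =>
    let f : LinearMap.ker (linCA a b ^ (n + 1)) → LinearMap.ker (linCA a b ^ n) × ZMod p :=
      fun d => (⟨linCA a b d.1, by
        have := d.2
        rwa [LinearMap.mem_ker, pow_succ_apply_eq] at this⟩, d.1 0)
    refine Finite.of_injective f fun d d' h => ?_
    obtain ⟨h1, h2⟩ := Prod.mk.inj h
    have h1 := Subtype.mk.inj h1
    have : d.1 - d'.1 = 0 := eq_zero_of_linCA_eq_zero ha hb (s := 0)
      (by rw [map_sub, h1, sub_self]) (by simp [h2])
    exact Subtype.ext (sub_eq_zero.1 this)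

/-- The kernel of the `p^m`-th power of `linCA` is fixed by the shift to the power
`(p-1)p^m`. -/
lemma iterate_shiftMap_of_mem_ker (ha : a ≠ 0) (hb : b ≠ 0) (m : ℕ) {v : ℤ → ZMod p}
    (hv : (linCA a b ^ p ^ m) v = 0) : shiftMap^[(p - 1) * p ^ m] v = v := by
  have : CharP (Module.End (ZMod p) (ℤ → ZMod p)) p := by
    refine charP_of_injective_algebraMap
      (algebraMap (ZMod p) (Module.End (ZMod p) (ℤ → ZMod p))).injective p
  have hc : Commute (a • LinearMap.id : Module.End (ZMod p) (ℤ → ZMod p)) (b • shiftLin p) := by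
    ext v i
    simp [shiftMap, mul_left_comm]
  have h1 : linCA a b ^ p ^ m = a • LinearMap.id + b • shiftLin p ^ p ^ m := by
    have : linCA a b ^ p ^ m = (a • LinearMap.id : Module.End (ZMod p) (ℤ → ZMod p)) ^ p ^ m
        + (b • shiftLin p) ^ p ^ m := add_pow_char_pow_of_commute p m hc
    rw [this, smul_pow, smul_pow, ZMod.pow_card_pow, ZMod.pow_card_pow]
    congr 2
    exact one_pow _
  have h2 : (shiftLin p ^ p ^ m) v = (-(b⁻¹ * a)) • v := by
    rw [h1] at hv
    have : a • v + b • (shiftLin p ^ p ^ m) v = 0 := hv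
    have h3 : b⁻¹ • (a • v + b • (shiftLin p ^ p ^ m) v) = 0 := by rw [this, smul_zero]
    rw [smul_add, smul_smul, smul_smul, inv_mul_cancel₀ hb, one_smul, add_comm] at h3
    rw [eq_neg_of_add_eq_zero_left h3, neg_smul]
  have h3 : ∀ k : ℕ, ((shiftLin p ^ p ^ m) ^ k) v = (-(b⁻¹ * a)) ^ k • v := by
    intro k
    induction k with
    | zero => simp
    | succ k ih =>
      rw [pow_succ, Module.End.mul_apply, h2, map_smul, ih, smul_smul, pow_succ']
  have h4 := h3 (p - 1)
  rw [ZMod.pow_card_sub_one_eq_one (by simp [ha, hb]), one_smul, ← pow_mul, shiftLin_pow_apply,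
    mul_comm] at h4
  exact h4

/-- A shift-stable subgroup containing an element not killed by `linCA ^ i` contains the kernel of
`linCA ^ (i+1)`. -/
lemma ker_le_of_shift_stable (ha : a ≠ 0) (hb : b ≠ 0) (K : AddSubgroup (ℤ → ZMod p))
    (hK : ∀ k ∈ K, shiftMap k ∈ K) {n i : ℕ} {k : ℤ → ZMod p} (hk : k ∈ K)
    (hkn : (linCA a b ^ n) k = 0) (hki : (linCA a b ^ i) k ≠ 0) :
    ∀ e, (linCA a b ^ (i + 1)) e = 0 → e ∈ K := by
  have hsmul : ∀ (c : ZMod p), ∀ k ∈ K, c • k ∈ K := by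
    intro c k hk
    rw [← ZMod.natCast_zmod_val c, Nat.cast_smul_eq_nsmul]
    exact K.nsmul_mem hk _
  have hL : ∀ r : ℕ, ∀ k ∈ K, (linCA a b ^ r) k ∈ K := by
    intro r
    induction r with
    | zero => intro k hk; simpa using hk
    | succ r ih =>
      intro k hk
      rw [pow_succ_apply_eq]
      exact ih _ (K.add_mem (hsmul a k hk) (hsmul b _ (hK k hk)))
  obtain ⟨q, hq, hq', hiq⟩ : ∃ q, (linCA a b ^ q) k ≠ 0 ∧ (linCA a b ^ (q + 1)) k = 0 ∧ i ≤ q := by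
    classical
    have hex : ∃ q, (linCA a b ^ q) k = 0 := ⟨n, hkn⟩
    have h0 : ∀ q, (linCA a b ^ q) k = 0 → ∀ r, (linCA a b ^ (q + r)) k = 0 := by
      intro q hq r
      rw [add_comm, pow_add, Module.End.mul_apply, hq, map_zero]
    have hlt : i < Nat.find hex := by
      by_contra hle
      apply hki
      have := h0 _ (Nat.find_spec hex) (i - Nat.find hex)
      rwa [Nat.add_sub_cancel' (not_lt.1 hle)] at this
    refine ⟨Nat.find hex - 1, Nat.find_min hex (by omega), ?_, by omega⟩
    rw [Nat.sub_add_cancel (by omega)]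
    exact Nat.find_spec hex
  have key : ∀ r, r ≤ q + 1 → ∀ e, (linCA a b ^ r) e = 0 → e ∈ K := by
    intro r
    induction r with
    | zero => intro _ e he; rw [pow_zero, Module.End.one_apply] at he; rw [he]; exact K.zero_mem
    | succ r ih =>
      intro hr e he
      set w := (linCA a b ^ q) k with hw
      have hw0 : w 0 ≠ 0 := fun h => hq
        (eq_zero_of_linCA_eq_zero ha hb (by rw [hw, ← pow_succ_apply_eq', hq']) h)
      set c := ((linCA a b ^ r) e 0) / w 0 with hc
      have h1 : (linCA a b ^ r) e - c • w = 0 := by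
        refine eq_zero_of_linCA_eq_zero (s := 0) ha hb ?_ ?_
        · rw [map_sub, map_smul, ← pow_succ_apply_eq', he, hw, ← pow_succ_apply_eq', hq']
          simp
        · simp only [Pi.sub_apply, Pi.smul_apply, smul_eq_mul, hc]
          field_simp
          ring
      have h2 : e - c • (linCA a b ^ (q - r)) k ∈ K := by
        apply ih (by omega)
        rw [map_sub, map_smul, ← Module.End.mul_apply, ← pow_add,
          Nat.add_sub_cancel' (by omega : r ≤ q)]
        exact h1
      have := K.add_mem h2 (hsmul c _ (hL (q - r) k hk))
      simpa using this
  exact fun e he => key (i + 1) (by omega) e he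

/-- If `K` is a shift-stable subgroup and `shiftMap d - d ∈ K` for an element `d` of the kernel of
`linCA ^ n` which is not in the kernel of `linCA ^ j`, then `K` contains the latter. -/
lemma ker_le_of_shift_sub_mem (ha : a ≠ 0) (hb : b ≠ 0) (K : AddSubgroup (ℤ → ZMod p))
    (hK : ∀ k ∈ K, shiftMap k ∈ K) {n j : ℕ} {d : ℤ → ZMod p}
    (hd : shiftMap d - d ∈ K) (hdn : (linCA a b ^ n) d = 0) (hdj : (linCA a b ^ j) d ≠ 0) :
    ∀ e, (linCA a b ^ j) e = 0 → e ∈ K := by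
  rcases j with _ | i
  · intro e he
    rw [pow_zero, Module.End.one_apply] at he; rw [he]; exact K.zero_mem
  have hcomm : ∀ r (v : ℤ → ZMod p),
      (linCA a b ^ r) (shiftMap v) = shiftMap ((linCA a b ^ r) v) := fun r v =>
    (congrFun (congrArg DFunLike.coe ((commute_shiftLin_linCA a b).pow_right r).eq) v).symm
  refine ker_le_of_shift_stable (n := n) ha hb K hK hd ?_ ?_
  · rw [map_sub, hcomm, hdn]; simp; rfl
  · intro h
    set y := (linCA a b ^ i) d with hy
    rw [map_sub, hcomm, sub_eq_zero] at h
    have hLy : linCA a b y = (a + b) • y := by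
      ext i
      have hi : y (i + 1) = y i := congrFun h i
      simp only [linCA_apply, hi, Pi.smul_apply, smul_eq_mul, add_mul]
    have hLr : ∀ r : ℕ, (linCA a b ^ r) y = (a + b) ^ r • y := by
      intro r
      induction r with
      | zero => simp
      | succ r ih => rw [pow_succ_apply_eq, hLy, map_smul, ih, smul_smul, pow_succ']
    have hy1 : linCA a b y ≠ 0 := by rwa [hy, ← pow_succ_apply_eq']
    have hab : a + b ≠ 0 := by
      intro h0; rw [hLy, h0, zero_smul] at hy1; exact hy1 rfl
    have hy0 : y ≠ 0 := by
      intro h0; rw [h0, map_zero] at hy1; exact hy1 rfl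
    have : (linCA a b ^ n) y = 0 := by
      rw [hy, ← Module.End.mul_apply, ← pow_add, add_comm, pow_add, Module.End.mul_apply, hdn,
        map_zero]
    rw [hLr] at this
    exact hy0 ((smul_eq_zero.1 this).resolve_left (pow_ne_zero _ hab))

end FullShift

section Chains

variable {A : Type*} {E : Set (A × A)}

lemma mem_TMC_shift {x : ℤ → A} (hx : x ∈ TMC E) (k : ℤ) : (fun n => x (n + k)) ∈ TMC E := by
  intro i
  have := hx (i + k)
  rwa [show i + k + 1 = i + 1 + k by ring] at this

lemma mem_TMC_glue {x y : ℤ → A} (hx : x ∈ TMC E) (hy : y ∈ TMC E) {s : ℤ}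
    (h : (x s, y (s + 1)) ∈ E) : (fun n => if n ≤ s then x n else y n) ∈ TMC E := by
  intro i
  rcases lt_trichotomy i s with hi | rfl | hi
  · simpa [hi.le, Int.add_one_le_of_lt hi] using hx i
  · simpa using h
  · simpa [not_le.2 hi, not_le.2 (hi.trans (lt_add_one i))] using hy i

lemma mem_TMC_iterate {x : ℤ → A} (hx : x ∈ TMC E) (k : ℕ) : shiftMap^[k] x ∈ TMC E := by
  have := mem_TMC_shift hx k
  convert this using 1
  ext n
  exact iterate_shiftMap_apply x k n

lemma exists_mem_TMC_of_edge (hE : EveryLetterOccurs E) {a b : A} (h : (a, b) ∈ E) :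
    ∃ x ∈ TMC E, x 0 = a ∧ x 1 = b := by
  obtain ⟨x, hx, i, rfl⟩ := hE a
  obtain ⟨y, hy, j, rfl⟩ := hE b
  refine ⟨_, mem_TMC_glue (mem_TMC_shift hx i) (mem_TMC_shift hy (j - 1)) (s := 0) ?_, ?_, ?_⟩
  · simpa using h
  · simp
  · simp

lemma wordIn_snoc_iff (hE : EveryLetterOccurs E) {m : ℕ} (w : Fin (m + 1) → A) (b : A) :
    WordIn (TMC E) (Fin.snoc (α := fun _ => A) w b) ↔
      WordIn (TMC E) w ∧ (w (Fin.last m), b) ∈ E := by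
  constructor
  · rintro ⟨x, hx, j, h⟩
    have h1 : ∀ i : Fin (m + 1), x (j + ((i : ℕ) : ℤ)) = w i := fun i => by
      simpa using h i.castSucc
    refine ⟨⟨x, hx, j, h1⟩, ?_⟩
    have h2 := h (Fin.last (m + 1))
    have h3 := h1 (Fin.last m)
    rw [Fin.snoc_last] at h2
    rw [← h2, ← h3]
    convert hx _ using 3
    simp; ring
  · rintro ⟨⟨x, hx, j, h⟩, hb⟩
    obtain ⟨y, hy, hy0, hy1⟩ := exists_mem_TMC_of_edge hE hb
    refine ⟨_, mem_TMC_glue hx (mem_TMC_shift hy (-(j + m))) (s := j + m) ?_, j, fun i => ?_⟩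
    · have := h (Fin.last m)
      simp only [Fin.val_last] at this
      rw [this, show j + m + 1 + -(j + m) = (1 : ℤ) by ring, hy1]
      exact hb
    · refine Fin.lastCases ?_ (fun i => ?_) i
      · have h1 : j + ((m : ℤ) + 1) + -(j + m) = 1 := by ring
        simp [-neg_add_rev, h1, hy1]
      · have : (i : ℤ) ≤ m := by have := i.2; omega
        simp [this, h i]

end Chains

section Coset

variable {M : Type*} [AddCommGroup M]

/-- A finite set stable under `(x, y) ↦ A x + B y + C` is a coset of a subgroup stable under `A`
and `B`. -/
lemma exists_addSubgroup_of_affine_stable {E : Set M} (hfin : E.Finite) (hne : E.Nonempty)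
    (A B : M ≃+ M) (C : M) (hE : ∀ x ∈ E, ∀ y ∈ E, A x + B y + C ∈ E) :
    ∃ H : AddSubgroup M, (∀ e ∈ E, ∀ x, x ∈ E ↔ x - e ∈ H) ∧ (∀ h ∈ H, A h ∈ H) ∧
      ∀ h ∈ H, B h ∈ H := by
  have hiff : ∀ y ∈ E, ∀ x, A x + B y + C ∈ E ↔ x ∈ E := by
    intro y hy x
    refine ⟨fun hx => ?_, fun hx => hE x hx y hy⟩
    have hm : Set.MapsTo (fun x => A x + B y + C) E E := fun x hx => hE x hx y hy
    have hinj : Function.Injective (fun x => A x + B y + C) := fun x x' h => by simpa using h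
    obtain ⟨x', hx', h⟩ := ((hfin.injOn_iff_bijOn_of_mapsTo hm).1 hinj.injOn).surjOn hx
    exact hinj h ▸ hx'
  let H : AddSubgroup M :=
    { carrier := {h | ∀ e, e + h ∈ E ↔ e ∈ E}
      add_mem' := fun {a b} ha hb e => by rw [← add_assoc, hb, ha]
      zero_mem' := fun e => by rw [add_zero]
      neg_mem' := fun {a} ha e => by rw [← ha (e + -a), neg_add_cancel_right] }
  have hB : ∀ y₁ ∈ E, ∀ y₂ ∈ E, B (y₁ - y₂) ∈ H := by
    intro y₁ h₁ y₂ h₂ e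
    have h := (hiff y₁ h₁ (A.symm (e - B y₂ - C))).trans (hiff y₂ h₂ (A.symm (e - B y₂ - C))).symm
    rw [AddEquiv.apply_symm_apply] at h
    convert h using 2
    · rw [map_sub]; abel
    · abel
  obtain ⟨e₀, he₀⟩ := hne
  have key : ∀ x, x ∈ E → x - e₀ ∈ H := by
    have := hfin.to_subtype
    let f : H → E := fun h => ⟨e₀ + h, (h.2 e₀).2 he₀⟩
    let g : E → H := fun y => ⟨B (y - e₀), hB y y.2 e₀ he₀⟩
    have hf : Function.Injective f := fun x y h => by
      have := Subtype.mk.inj h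
      exact Subtype.ext (add_left_cancel this)
    have hg : Function.Injective g := fun x y h => by
      have := B.injective (Subtype.mk.inj h)
      exact Subtype.ext (sub_left_injective this)
    intro x hx
    obtain ⟨y, hy⟩ := (Finite.injective_iff_surjective.1 (hf.comp hg)) ⟨x, hx⟩
    have : e₀ + (g y : M) = x := Subtype.mk.inj hy
    rw [← this, add_sub_cancel_left]
    exact (g y).2
  have key' : ∀ x ∈ E, ∀ e ∈ E, x - e ∈ H := fun x hx e he => by
    have := H.sub_mem (key x hx) (key e he)
    rwa [sub_sub_sub_cancel_right] at this
  refine ⟨H, fun e he x => ⟨fun hx => key' x hx e he, fun h => ?_⟩, fun h hh => ?_, fun h hh => ?_⟩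
  · have := (h e).2 he
    rwa [add_sub_cancel] at this
  · have h1 := hE _ ((hh e₀).2 he₀) _ he₀
    have h2 := key' _ h1 _ (hE _ he₀ _ he₀)
    convert h2 using 1
    rw [map_add]; abel
  · have h1 := hE _ he₀ _ ((hh e₀).2 he₀)
    have h2 := key' _ h1 _ (hE _ he₀ _ he₀)
    convert h2 using 1
    rw [map_add]; abel

end Coset

section Counting

variable {G : Type*} [Fintype G] {E : Set (G × G)}

/-- The number of words of length `m + 1` in a chain with constant out-degree. -/
lemma ncard_words (hE : EveryLetterOccurs E) {d : ℕ}
    (hd : ∀ a, {b | (a, b) ∈ E}.ncard = d) (m : ℕ) :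
    {w : Fin (m + 1) → G | WordIn (TMC E) w}.ncard = Fintype.card G * d ^ m := by
  classical
  induction m with
  | zero =>
    have : {w : Fin (0 + 1) → G | WordIn (TMC E) w} = Set.univ := by
      refine Set.eq_univ_of_forall fun w => ?_
      obtain ⟨x, hx, i, hi⟩ := hE (w 0)
      exact ⟨x, hx, i, fun j => by
        obtain rfl : j = 0 := Fin.ext (by omega)
        simpa using hi⟩
    rw [this, Set.ncard_univ]
    simp
  | succ m ih =>
    rw [Set.ncard_eq_toFinset_card'] at ih ⊢
    rw [Finset.card_eq_sum_card_fiberwise (f := fun w : Fin (m + 1 + 1) → G => Fin.init w)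
      (t := {w : Fin (m + 1) → G | WordIn (TMC E) w}.toFinset)]
    · rw [Finset.sum_const_nat (m := d), ih, pow_succ, mul_assoc]
      intro w hw
      rw [← hd (w (Fin.last m)), Set.ncard_eq_toFinset_card']
      symm
      refine Finset.card_bij (fun b _ => Fin.snoc (α := fun _ => G) w b) ?_ ?_ ?_
      · intro b hb
        simp only [Set.mem_toFinset, Set.mem_ofPred_eq] at hw hb
        simp only [Finset.mem_filter, Set.mem_toFinset, Set.mem_ofPred_eq, Fin.init_snoc, and_true]
        exact (wordIn_snoc_iff hE w b).2 ⟨hw, hb⟩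
      · intro b _ b' _ h
        have := congrFun h (Fin.last (m + 1))
        simpa using this
      · intro w' hw'
        simp only [Finset.mem_filter, Set.mem_toFinset, Set.mem_ofPred_eq] at hw'
        obtain ⟨h1, rfl⟩ := hw'
        refine ⟨w' (Fin.last _), ?_, Fin.snoc_init_self w'⟩
        rw [← Fin.snoc_init_self w'] at h1
        simpa using ((wordIn_snoc_iff hE _ _).1 h1).2
    · intro w hw
      simp only [Set.coe_toFinset, Set.mem_ofPred_eq] at hw ⊢
      rw [← Fin.snoc_init_self w] at hw
      exact ((wordIn_snoc_iff hE _ _).1 hw).1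

/-- The out-degree is the exponential of the entropy. -/
lemma outdegree_eq (hE : EveryLetterOccurs E) [Nonempty G] {d p : ℕ} (hd0 : 0 < d) (hp : 0 < p)
    (hd : ∀ a, {b | (a, b) ∈ E}.ncard = d)
    (hent : Tendsto (fun m : ℕ => Real.log ({w : Fin m → G | WordIn (TMC E) w}.ncard) / m)
      atTop (nhds (Real.log p))) : d = p := by
  have h1 : Tendsto (fun m : ℕ => Real.log ({w : Fin m → G | WordIn (TMC E) w}.ncard) / m)
      atTop (nhds (Real.log d)) := by
    rw [← tendsto_add_atTop_iff_nat 1]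
    have h2 : ∀ m : ℕ, Real.log ({w : Fin (m + 1) → G | WordIn (TMC E) w}.ncard) / (m + 1 : ℕ)
        = Real.log d + (Real.log (Fintype.card G) - Real.log d) / ((m : ℝ) + 1) := by
      intro m
      rw [ncard_words hE hd]
      have : (Fintype.card G : ℝ) ≠ 0 := by simp
      have : (d : ℝ) ≠ 0 := by positivity
      push_cast
      rw [Real.log_mul (by assumption) (by positivity), Real.log_pow]
      field_simp
      ring
    simp_rw [h2]
    have := (tendsto_const_div_atTop_nhds_zero_nat
      (Real.log (Fintype.card G) - Real.log d)).comp (tendsto_add_atTop_nat 1)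
    simpa [Function.comp_def] using this.const_add (Real.log d)
  have := tendsto_nhds_unique h1 hent
  exact_mod_cast Real.log_injOn_pos (show (0 : ℝ) < d by positivity)
    (show (0 : ℝ) < p by positivity) this

/-- If all out-degrees are equal to `d` and all in-degrees to `d'`, then `d = d'`. -/
lemma outdegree_eq_indegree [Nonempty G] {d d' : ℕ} (hd : ∀ a, {b | (a, b) ∈ E}.ncard = d)
    (hd' : ∀ b, {a | (a, b) ∈ E}.ncard = d') : d = d' := by
  classical
  have h1 : ∑ a : G, ∑ b : G, (if (a, b) ∈ E then 1 else 0) = Fintype.card G * d := by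
    rw [← Finset.card_univ]
    refine Finset.sum_const_nat fun a _ => ?_
    rw [← hd a, Set.ncard_eq_toFinset_card', Finset.card_eq_sum_ones, ← Finset.sum_filter]
    congr 1; ext; simp
  have h2 : ∑ b : G, ∑ a : G, (if (a, b) ∈ E then 1 else 0) = Fintype.card G * d' := by
    rw [← Finset.card_univ]
    refine Finset.sum_const_nat fun b _ => ?_
    rw [← hd' b, Set.ncard_eq_toFinset_card', Finset.card_eq_sum_ones, ← Finset.sum_filter]
    congr 1; ext; simp
  rw [Finset.sum_comm, h1] at h2
  exact Nat.eq_of_mul_eq_mul_left Fintype.card_pos h2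

end Counting

section Strip

variable {G : Type*} [AddCommGroup G] {p : ℕ}

/-- The block map attached to a family `θ` of finitely supported sequences. -/
def blockMap (θ : ZMod p →+ (ℤ → G)) (ℓ : ℕ) : (ℤ → ZMod p) →+ (ℤ → G) where
  toFun v n := ∑ k ∈ Finset.range (ℓ + 1), θ (v (n - k)) k
  map_zero' := by ext; simp
  map_add' v w := by ext; simp [Finset.sum_add_distrib]

lemma blockMap_apply (θ : ZMod p →+ (ℤ → G)) (ℓ : ℕ) (v : ℤ → ZMod p) (n : ℤ) :
    blockMap θ ℓ v n = ∑ k ∈ Finset.range (ℓ + 1), θ (v (n - k)) k := rfl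

lemma blockMap_shift (θ : ZMod p →+ (ℤ → G)) (ℓ : ℕ) (v : ℤ → ZMod p) :
    blockMap θ ℓ (shiftMap v) = shiftMap (blockMap θ ℓ v) := by
  ext n
  simp only [blockMap_apply, shiftMap]
  refine Finset.sum_congr rfl fun k _ => ?_
  rw [show n - (k : ℤ) + 1 = n + 1 - k by ring]

/-- A family `θ` of points of the group chain `TMC H`, supported in `[1, ℓ]`, where `ℓ` is
the minimal length of the support of a nonzero finitely supported point. -/
structure IsStrip (H : AddSubgroup (G × G)) (θ : ZMod p →+ (ℤ → G)) (ℓ : ℕ) : Prop where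
  mem : ∀ c i, (θ c i, θ c (i + 1)) ∈ H
  left : ∀ c i, i ≤ 0 → θ c i = 0
  right : ∀ c i, (ℓ : ℤ) < i → θ c i = 0
  inj : ∀ c, θ c 1 = 0 → c = 0
  surj : ∀ b, (0, b) ∈ H → ∃ c, θ c 1 = b
  min : ∀ g : ℤ → G, (∀ i, (g i, g (i + 1)) ∈ H) → ∀ s, (∀ i ≤ s, g i = 0) →
    (∀ i, s + ℓ ≤ i → g i = 0) → g = 0

namespace IsStrip

variable {H : AddSubgroup (G × G)} {θ : ZMod p →+ (ℤ → G)} {ℓ : ℕ} (hθ : IsStrip H θ ℓ)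
include hθ

lemma blockMap_eq_zero {v : ℤ → ZMod p} {n : ℤ} (h : ∀ i, n - ℓ ≤ i → i < n → v i = 0) :
    blockMap θ ℓ v n = 0 := by
  rw [blockMap_apply]
  refine Finset.sum_eq_zero fun k hk => ?_
  rw [Finset.mem_range] at hk
  rcases Nat.eq_zero_or_pos k with rfl | hk0
  · exact hθ.left _ _ (by simp)
  · rw [h (n - k) (by omega) (by omega)]
    simp

lemma blockMap_eq {v w : ℤ → ZMod p} {n : ℤ} (h : ∀ i, n - ℓ ≤ i → i < n → v i = w i) :
    blockMap θ ℓ v n = blockMap θ ℓ w n := by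
  rw [← sub_eq_zero, ← Pi.sub_apply, ← map_sub]
  exact hθ.blockMap_eq_zero fun i h1 h2 => by simp [h i h1 h2]

lemma blockMap_single_succ (n : ℤ) (c : ZMod p) :
    blockMap θ ℓ (Pi.single n c) (n + 1) = θ c 1 := by
  rw [blockMap_apply, Finset.sum_eq_single 1]
  · simp
  · intro k _ hk
    rw [Pi.single_eq_of_ne (by omega)]
    simp
  · intro h
    have : (ℓ : ℤ) < 1 := by simp at h; omega
    simpa using hθ.right _ _ (by exact_mod_cast this)

lemma blockMap_mem (v : ℤ → ZMod p) (n : ℤ) :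
    (blockMap θ ℓ v n, blockMap θ ℓ v (n + 1)) ∈ H := by
  have h1 : blockMap θ ℓ v (n + 1) = ∑ k ∈ Finset.range (ℓ + 1), θ (v (n - k)) (k + 1) := by
    have h2 : blockMap θ ℓ v (n + 1) =
        ∑ k ∈ Finset.range (ℓ + 1 + 1), θ (v (n + 1 - k)) k := by
      rw [Finset.sum_range_succ, ← blockMap_apply, hθ.right _ _ (by push_cast; omega), add_zero]
    rw [h2, Finset.sum_range_succ', hθ.left _ _ (by simp), add_zero]
    refine Finset.sum_congr rfl fun k _ => ?_
    push_cast
    rw [show n + 1 - ((k : ℤ) + 1) = n - k by ring]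
  have h2 := H.sum_mem (t := Finset.range (ℓ + 1)) fun k _ => hθ.mem (v (n - k)) k
  rw [← Prod.mk.eta (p := ∑ k ∈ Finset.range (ℓ + 1), _), Prod.fst_sum, Prod.snd_sum] at h2
  rwa [h1, blockMap_apply]

lemma blockMap_injOn {w : ℤ → ZMod p} {s : ℤ} (h0 : blockMap θ ℓ w s = 0)
    (h1 : blockMap θ ℓ w (s + 1) = 0) : w s = 0 := by
  let w' : ℤ → ZMod p := fun i => if i < s then w i else 0
  have e0 : blockMap θ ℓ w' s = 0 := by
    rw [← h0]
    exact hθ.blockMap_eq fun i _ hi => by simp [w', hi]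
  let g : ℤ → G := fun n => if n ≤ s then 0 else blockMap θ ℓ w' n
  have hg : g = 0 := by
    refine hθ.min g (fun i => ?_) s (fun i hi => by simp [g, hi]) (fun i hi => ?_)
    · have hz : ((0 : G), (0 : G)) ∈ H := H.zero_mem
      rcases lt_trichotomy i s with h | rfl | h
      · simpa [g, h.le, Int.add_one_le_of_lt h] 
      · simpa [g, e0] using hθ.blockMap_mem w' i
      · simpa [g, not_le.2 h, not_le.2 (h.trans (lt_add_one i))] using hθ.blockMap_mem w' i
    · by_cases h : i ≤ s
      · simp [g, h]
      · simp only [g, h, if_false]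
        refine hθ.blockMap_eq_zero fun j hj _ => ?_
        simp [w', show ¬ j < s by omega]
  have e1 : blockMap θ ℓ w' (s + 1) = 0 := by simpa [g] using congrFun hg (s + 1)
  have e2 : blockMap θ ℓ w (s + 1) = blockMap θ ℓ (w' + Pi.single s (w s)) (s + 1) := by
    refine hθ.blockMap_eq fun i _ hi => ?_
    rcases (Int.lt_add_one_iff.1 hi).lt_or_eq with h | rfl
    · simp [w', h, Pi.single_eq_of_ne h.ne]
    · simp [w']
  rw [map_add, Pi.add_apply, e1, zero_add, hθ.blockMap_single_succ, h1] at e2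
  exact hθ.inj _ e2.symm

lemma exists_blockMap_eq {g : ℤ → G} (hg : ∀ i, (g i, g (i + 1)) ∈ H) {v : ℤ → ZMod p} {s : ℤ}
    (hs : blockMap θ ℓ v s = g s) (M : ℕ) :
    ∃ u, ∀ n, s ≤ n → n ≤ s + M → blockMap θ ℓ u n = g n := by
  induction M with
  | zero =>
    refine ⟨v, fun n h1 h2 => ?_⟩
    obtain rfl : n = s := by simp at h2; omega
    exact hs
  | succ M ih =>
    obtain ⟨u, hu⟩ := ih
    have h1 := H.sub_mem (hg (s + M)) (hθ.blockMap_mem u (s + M))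
    rw [Prod.mk_sub_mk, hu (s + M) (by omega) le_rfl, sub_self] at h1
    obtain ⟨c, hc⟩ := hθ.surj _ h1
    refine ⟨u + Pi.single (s + M) c, fun n h2 h3 => ?_⟩
    push_cast at h3
    rw [map_add, Pi.add_apply]
    rcases (show n ≤ s + M ∨ n = s + M + 1 by omega) with h | rfl
    · rw [hu n h2 h, hθ.blockMap_eq_zero (v := Pi.single _ _), add_zero]
      intro i _ hi
      exact Pi.single_eq_of_ne (by omega) _
    · rw [hθ.blockMap_single_succ, hc]
      abel

lemma exists_endo [Fact p.Prime] (f : G →+ G) (hf : Function.Injective f) (hfH : ∀ h ∈ H, (f h.1, f h.2) ∈ H) :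
    ∃ a : ZMod p, a ≠ 0 ∧ ∀ c i, f (θ c i) = θ (a * c) i := by
  have h1 : ((0 : G), f (θ 1 1)) ∈ H := by
    have := hfH _ (hθ.mem 1 0)
    rw [hθ.left 1 0 le_rfl] at this
    simpa using this
  obtain ⟨a, ha⟩ := hθ.surj _ h1
  have key : ∀ i, f (θ 1 i) = θ a i := by
    have : (fun i => f (θ 1 i) - θ a i) = 0 := by
      refine hθ.min _ (fun i => ?_) 1 (fun i hi => ?_) (fun i hi => ?_)
      · exact H.sub_mem (hfH _ (hθ.mem 1 i)) (hθ.mem a i)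
      · rcases hi.lt_or_eq with h | rfl
        · rw [hθ.left _ _ (by omega), hθ.left _ _ (by omega)]; simp
        · rw [ha, sub_self]
      · rw [hθ.right _ _ (by omega), hθ.right _ _ (by omega)]; simp
    intro i
    exact sub_eq_zero.1 (congrFun this i)
  refine ⟨a, fun h => ?_, fun c i => ?_⟩
  · have h2 := key 1
    rw [h, map_zero, Pi.zero_apply] at h2
    exact one_ne_zero (hθ.inj 1 (hf (by rw [h2, map_zero])))
  · obtain ⟨n, rfl⟩ := ZMod.intCast_surjective c
    have e1 : ((n : ℤ) : ZMod p) = n • (1 : ZMod p) := by simp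
    have e2 : a * ((n : ℤ) : ZMod p) = n • a := by rw [e1]; simp [mul_comm]
    rw [e2, e1, map_zsmul, map_zsmul, Pi.smul_apply, Pi.smul_apply, map_zsmul, key]

end IsStrip

lemma exists_isStrip {H : AddSubgroup (G × G)} [Fact p.Prime]
    (hcard : {b : G | ((0 : G), b) ∈ H}.ncard = p)
    (hex : ∃ g : ℤ → G, (∀ i, (g i, g (i + 1)) ∈ H) ∧ g ≠ 0 ∧
      ∃ (s : ℤ) (ℓ : ℕ), (∀ i ≤ s, g i = 0) ∧ ∀ i, s + ℓ < i → g i = 0) :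
    ∃ (θ : ZMod p →+ (ℤ → G)) (ℓ : ℕ), IsStrip H θ ℓ := by
  classical
  have hex' : ∃ ℓ : ℕ, ∃ g : ℤ → G, (∀ i, (g i, g (i + 1)) ∈ H) ∧ g ≠ 0 ∧
      ∃ s : ℤ, (∀ i ≤ s, g i = 0) ∧ ∀ i, s + ℓ < i → g i = 0 := by
    obtain ⟨g, h1, h2, s, ℓ, h3⟩ := hex
    exact ⟨ℓ, g, h1, h2, s, h3⟩
  have hmin := fun m => Nat.find_min (m := m) hex'
  obtain ⟨g, hgH, hg0, s, hgl, hgr⟩ := Nat.find_spec hex'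
  set ℓ := Nat.find hex' with hℓ
  have hℓ1 : 1 ≤ ℓ := by
    by_contra h
    refine hg0 (funext fun i => ?_)
    by_cases hi : i ≤ s
    · exact hgl i hi
    · exact hgr i (by omega)
  have hmin' : ∀ g : ℤ → G, (∀ i, (g i, g (i + 1)) ∈ H) → ∀ s, (∀ i ≤ s, g i = 0) →
      (∀ i, s + ℓ ≤ i → g i = 0) → g = 0 := by
    intro g' h1 s' h2 h3
    by_contra h
    refine hmin (ℓ - 1) (by omega) ⟨g', h1, h, s', h2, fun i hi => h3 i ?_⟩
    omega
  have h1 : g (s + 1) ≠ 0 := by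
    intro h
    refine hg0 (hmin' g hgH (s + 1) (fun i hi => ?_) fun i hi => hgr i (by omega))
    rcases hi.lt_or_eq with h' | rfl
    · exact hgl i (by omega)
    · exact h
  have h1mem : ((0 : G), g (s + 1)) ∈ H := by
    have := hgH s
    rwa [hgl s le_rfl] at this
  let H0 : AddSubgroup G := H.comap (AddMonoidHom.inr G G)
  have hH0 : Nat.card H0 = p := hcard
  have hpg : ∀ b ∈ H0, p • b = 0 := by
    intro b hb
    have : p • (⟨b, hb⟩ : H0) = 0 := by
      rw [← hH0]
      exact card_nsmul_eq_zero'
    exact congrArg Subtype.val this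
  let h : ℤ → G := fun n => g (n + s)
  have hH : ∀ i, (h i, h (i + 1)) ∈ H := fun i => by
    have := hgH (i + s)
    rwa [show i + s + 1 = i + 1 + s by ring] at this
  have hl : ∀ i, i ≤ 0 → h i = 0 := fun i hi => hgl _ (by omega)
  have hr : ∀ i, (ℓ : ℤ) < i → h i = 0 := fun i hi => hgr _ (by omega)
  have hh1 : h 1 = g (s + 1) := by simp only [h]; rw [add_comm]
  have hph : p • h = 0 := by
    refine hmin' _ (fun i => ?_) 1 (fun i hi => ?_) (fun i hi => ?_)
    · exact H.nsmul_mem (hH i) p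
    · rcases hi.lt_or_eq with h' | rfl
      · simp [hl i (by omega)]
      · rw [Pi.smul_apply, hh1]; exact hpg _ h1mem
    · simp [hr i (by omega)]
  let θ : ZMod p →+ (ℤ → G) := ZMod.lift p ⟨zmultiplesHom _ h, by simpa using hph⟩
  have hθ : ∀ n : ℤ, θ (n : ZMod p) = n • h := fun n => by
    simp only [θ, ZMod.lift_coe]; simp
  have hinj : ∀ c, θ c 1 = 0 → c = 0 := by
    intro c hc
    by_contra hc0
    have e : θ 1 1 = 0 := by
      have : (1 : ZMod p) = (c⁻¹).val • c := by
        rw [nsmul_eq_mul, ZMod.natCast_zmod_val, inv_mul_cancel₀ hc0]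
      rw [this, map_nsmul, Pi.smul_apply, hc, smul_zero]
    have e2 := hθ 1
    rw [Int.cast_one, one_smul] at e2
    rw [e2, hh1] at e
    exact h1 e
  have hmem : ∀ c i, (θ c i, θ c (i + 1)) ∈ H := by
    intro c i
    obtain ⟨n, rfl⟩ := ZMod.intCast_surjective c
    rw [hθ]
    exact H.zsmul_mem (hH i) n
  have hleft : ∀ c i, i ≤ 0 → θ c i = 0 := by
    intro c i hi
    obtain ⟨n, rfl⟩ := ZMod.intCast_surjective c
    rw [hθ, Pi.smul_apply, hl i hi, smul_zero]
  refine ⟨θ, ℓ, hmem, hleft, ?_, hinj, ?_, hmin'⟩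
  · intro c i hi
    obtain ⟨n, rfl⟩ := ZMod.intCast_surjective c
    rw [hθ, Pi.smul_apply, hr i hi, smul_zero]
  · have hf : Finite H0 := Nat.finite_of_card_ne_zero (by rw [hH0]; exact (Fact.out : p.Prime).ne_zero)
    let f : ZMod p → H0 := fun c => ⟨θ c 1, by
      have := hmem c 0
      rw [hleft c 0 le_rfl] at this
      simpa [H0] using this⟩
    have hfi : Function.Injective f := fun c c' hcc => by
      have e := Subtype.mk.inj hcc
      rw [← sub_eq_zero]
      exact hinj _ (by rw [map_sub, Pi.sub_apply, e, sub_self])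
    have hfb := (Nat.bijective_iff_injective_and_card f).2 ⟨hfi, by rw [Nat.card_zmod, hH0]⟩
    intro b hb
    obtain ⟨c, hc⟩ := hfb.2 ⟨b, hb⟩
    exact ⟨c, congrArg Subtype.val hc⟩

end Strip

section Coordinates

variable {G : Type*} [AddCommGroup G] {p : ℕ}

/-- Fibre coordinates for the cellular automaton `CA φ` on `TMC E`: translations by the points
`ι v` act on `TMC E` and intertwine `CA φ` with the linear cellular automaton `linCA a b`. -/
structure IsCoord (E : Set (G × G)) (φ : G → G → G) (a b : ZMod p)
    (ι : (ℤ → ZMod p) →+ (ℤ → G)) (ℓ : ℕ) : Prop where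
  a_ne : a ≠ 0
  b_ne : b ≠ 0
  shift : ∀ v, ι (shiftMap v) = shiftMap (ι v)
  eq_zero : ∀ v (n : ℤ), (∀ i, n - ℓ ≤ i → i < n → v i = 0) → ι v n = 0
  add_mem : ∀ x ∈ TMC E, ∀ v, x + ι v ∈ TMC E
  CA_add : ∀ x v, CA φ (x + ι v) = CA φ x + ι (linCA a b v)
  apply_eq_zero : ∀ w s, ι w s = 0 → ι w (s + 1) = 0 → w s = 0
  cover : ∀ x ∈ TMC E, ∀ y ∈ TMC E, ∀ v s, y s = x s + ι v s → ∀ M : ℕ,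
    ∃ u, ∀ n, s ≤ n → n ≤ s + M → y n = x n + ι u n
  CA_mem : ∀ x ∈ TMC E, CA φ x ∈ TMC E
  eq_of_CA_eq : ∀ x y s, CA φ x = CA φ y → x s = y s → x = y
  outdegree : ∀ g, {g' | (g, g') ∈ E}.ncard = p
  indegree : ∀ g', {g | (g, g') ∈ E}.ncard = p

lemma exists_isCoord [Finite G] {E : Set (G × G)} (hE : EveryLetterOccurs E)
    {φ : G → G → G} (hSC : SC E φ) (η ρa : G ≃+ G) (c : G)
    (hφ : ∀ a b, φ a b = η a + ρa b + c) [hp : Fact p.Prime]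
    (hent : Tendsto (fun m : ℕ => Real.log ({w : Fin m → G | WordIn (TMC E) w}.ncard) / m)
      atTop (nhds (Real.log p))) :
    ∃ (a b : ZMod p) (ι : (ℤ → ZMod p) →+ (ℤ → G)) (ℓ : ℕ), IsCoord E φ a b ι ℓ := by
  classical
  have := Fintype.ofFinite G
  have hstab : ∀ x ∈ E, ∀ y ∈ E,
      (η.prodCongr η) x + (ρa.prodCongr ρa) y + (c, c) ∈ E := by
    rintro ⟨x0, x1⟩ hx' ⟨y0, y1⟩ hy'
    obtain ⟨x, hx, rfl, rfl⟩ := exists_mem_TMC_of_edge hE hx'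
    obtain ⟨y, hy, rfl, rfl⟩ := exists_mem_TMC_of_edge hE hy'
    have h := hSC x hx y hy 0
    simp only [hφ, zero_add] at h
    exact h
  have hne : E.Nonempty := by
    obtain ⟨x, hx, i, _⟩ := hE 0
    exact ⟨_, hx i⟩
  obtain ⟨H, hEH, hηH, hρH⟩ :=
    exists_addSubgroup_of_affine_stable E.toFinite hne _ _ _ hstab
  have hdiff : ∀ x ∈ TMC E, ∀ y ∈ TMC E, ∀ i, (y i - x i, y (i + 1) - x (i + 1)) ∈ H :=
    fun x hx y hy i => (hEH _ (hx i) _).1 (hy i)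
  have hd : ∀ g, {g' | (g, g') ∈ E}.ncard = {b : G | ((0 : G), b) ∈ H}.ncard := by
    intro g
    obtain ⟨x, hx, i, rfl⟩ := hE g
    refine Set.ncard_congr (fun b _ => b - x (i + 1)) (fun b hb => ?_) (fun b b' _ _ h => ?_)
      fun b hb => ⟨b + x (i + 1), ?_, by simp⟩
    · simpa using (hEH _ (hx i) _).1 hb
    · simpa using h
    · exact (hEH _ (hx i) _).2 (by simpa using hb)
  have hd' : ∀ g', {g | (g, g') ∈ E}.ncard = {b : G | (b, (0 : G)) ∈ H}.ncard := by
    intro g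
    obtain ⟨x, hx, i, rfl⟩ := hE g
    have hxi := hx (i - 1)
    rw [sub_add_cancel] at hxi
    refine Set.ncard_congr (fun b _ => b - x (i - 1)) (fun b hb => ?_) (fun b b' _ _ h => ?_)
      fun b hb => ⟨b + x (i - 1), ?_, by simp⟩
    · simpa using (hEH _ hxi _).1 hb
    · simpa using h
    · exact (hEH _ hxi _).2 (by simpa using hb)
  have hd0 : 0 < {b : G | ((0 : G), b) ∈ H}.ncard :=
    (Set.ncard_pos (Set.toFinite _)).2 ⟨0, H.zero_mem⟩
  have hdp := outdegree_eq hE hd0 hp.out.pos hd hent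
  have hdd' := outdegree_eq_indegree hd hd'
  obtain ⟨θ, ℓ, hθ⟩ : ∃ (θ : ZMod p →+ (ℤ → G)) (ℓ : ℕ), IsStrip H θ ℓ := by
    refine exists_isStrip hdp ?_
    obtain ⟨m, hm⟩ : ∃ m : ℕ, Fintype.card G < p ^ m := ⟨_, Nat.lt_pow_self hp.out.one_lt⟩
    have hcard := ncard_words hE hd m
    rw [hdp, Set.ncard_eq_toFinset_card'] at hcard
    obtain ⟨w, hw, w', hw', hne, heq⟩ := Finset.exists_ne_map_eq_of_card_lt_of_maps_to
      (s := {w : Fin (m + 1) → G | WordIn (TMC E) w}.toFinset) (t := (Finset.univ : Finset (G × G)))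
      (f := fun w => (w 0, w (Fin.last m)))
      (by rw [hcard, Finset.card_univ, Fintype.card_prod]
          exact Nat.mul_lt_mul_of_pos_left hm Fintype.card_pos) (fun _ _ => Finset.mem_univ _)
    simp only [Set.mem_toFinset, Set.mem_ofPred_eq] at hw hw'
    obtain ⟨x, hx, j, hxw⟩ := hw
    obtain ⟨y, hy, j', hyw⟩ := hw'
    rw [Prod.mk.injEq, ← hxw, ← hxw, ← hyw, ← hyw] at heq
    simp only [Fin.val_zero, Nat.cast_zero, add_zero, Fin.val_last] at heq
    let g : ℤ → G := fun n => if 0 ≤ n ∧ n ≤ m then y (n + j') - x (n + j) else 0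
    have g0 : ∀ n, n ≤ 0 → g n = 0 := by
      intro n hn
      by_cases h : 0 ≤ n ∧ n ≤ m
      · obtain rfl : n = 0 := le_antisymm hn h.1
        simp [g, heq.1]
      · simp [g, h]
    have gm : ∀ n, (m : ℤ) ≤ n → g n = 0 := by
      intro n hn
      by_cases h : 0 ≤ n ∧ n ≤ m
      · obtain rfl : n = m := le_antisymm h.2 hn
        simp [g, add_comm (m : ℤ), heq.2]
      · simp [g, h]
    refine ⟨g, fun i => ?_, fun h => hne ?_, 0, m, g0, fun i hi => gm i (by omega)⟩
    · rcases lt_or_ge i 0 with h | h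
      · rw [g0 i h.le, g0 (i + 1) (by omega)]; exact H.zero_mem
      · rcases lt_or_ge i m with h' | h'
        · have := hdiff _ (mem_TMC_shift hx j) _ (mem_TMC_shift hy j') i
          simpa [g, h, h'.le, Int.add_one_le_of_lt h', show 0 ≤ i + 1 by omega] using this
        · rw [gm i h', gm (i + 1) (by omega)]; exact H.zero_mem
    · ext i
      have h1 := congrFun h (i : ℕ)
      have h2 : ((i : ℕ) : ℤ) ≤ m := by have := i.2; omega
      simp only [g, h2, Nat.cast_nonneg, and_self, if_true, Pi.zero_apply, sub_eq_zero] at h1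
      rw [← hxw, ← hyw, add_comm, ← h1, add_comm]
  obtain ⟨a, ha, haθ⟩ := hθ.exists_endo η.toAddMonoidHom η.injective (fun h hh => hηH h hh)
  obtain ⟨b, hb, hbθ⟩ := hθ.exists_endo ρa.toAddMonoidHom ρa.injective (fun h hh => hρH h hh)
  refine ⟨a, b, blockMap θ ℓ, ℓ, ha, hb, blockMap_shift θ ℓ, fun v n h => hθ.blockMap_eq_zero h,
    fun x hx v i => ?_, fun x v => ?_, fun w s => hθ.blockMap_injOn, fun x hx y hy v s h M => ?_,
    fun x hx => ?_, fun x y s h hs => ?_, fun g => (hd g).trans hdp,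
    fun g => (hd' g).trans (hdd'.symm.trans hdp)⟩
  · refine (hEH _ (hx i) _).2 ?_
    simpa using hθ.blockMap_mem v i
  · ext n
    have e1 : ∀ m, η (blockMap θ ℓ v m) = ∑ k ∈ Finset.range (ℓ + 1), θ (a * v (m - k)) k := by
      intro m
      rw [blockMap_apply, map_sum]
      exact Finset.sum_congr rfl fun k _ => haθ _ _
    have e2 : ∀ m, ρa (blockMap θ ℓ v m) = ∑ k ∈ Finset.range (ℓ + 1), θ (b * v (m - k)) k := by
      intro m
      rw [blockMap_apply, map_sum]
      exact Finset.sum_congr rfl fun k _ => hbθ _ _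
    have e3 : blockMap θ ℓ (linCA a b v) n =
        η (blockMap θ ℓ v n) + ρa (blockMap θ ℓ v (n + 1)) := by
      rw [e1, e2, blockMap_apply, ← Finset.sum_add_distrib]
      refine Finset.sum_congr rfl fun k _ => ?_
      rw [linCA_apply, map_add, Pi.add_apply, show n - (k : ℤ) + 1 = n + 1 - k by ring]
    simp only [CA, hφ, Pi.add_apply, e3, map_add]
    abel
  · obtain ⟨u, hu⟩ := hθ.exists_blockMap_eq (hdiff x hx y hy) (v := v) (s := s)
      (by rw [h]; abel) M
    exact ⟨u, fun n h1 h2 => by rw [hu n h1 h2]; abel⟩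
  · exact hSC x hx (shiftMap x) (fun i => hx (i + 1))
  · have h' : ∀ i, η (x i) + ρa (x (i + 1)) = η (y i) + ρa (y (i + 1)) := fun i => by
      simpa [CA, hφ] using congrFun h i
    ext i
    induction i using Int.inductionOn' (b := s) with
    | zero => exact hs
    | succ k _ ih =>
      have := h' k
      rw [ih] at this
      exact ρa.injective (add_left_cancel this)
    | pred k _ ih =>
      have := h' (k - 1)
      rw [sub_add_cancel, ih] at this
      exact η.injective (add_right_cancel this)

end Coordinates

lemma CA_shiftMap {G : Type*} (φ : G → G → G) (x : ℤ → G) :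
    CA φ (shiftMap x) = shiftMap (CA φ x) := rfl

lemma CA_iterate_shiftMap {G : Type*} (φ : G → G → G) (k : ℕ) (x : ℤ → G) :
    CA φ (shiftMap^[k] x) = shiftMap^[k] (CA φ x) :=
  ((show Function.Commute (CA φ) shiftMap from fun x => CA_shiftMap φ x).iterate_right k) x

section Linked

variable {G : Type*} [AddCommGroup G] {p : ℕ}

/-- The zeroth letters of `x` and `y` differ by that of a point `ι v`. -/
def Linked (ι : (ℤ → ZMod p) →+ (ℤ → G)) (x y : ℤ → G) : Prop := ∃ v, y 0 = x 0 + ι v 0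

variable {ι : (ℤ → ZMod p) →+ (ℤ → G)} {x y z : ℤ → G}

lemma Linked.of_eq (h : x 0 = y 0) : Linked ι x y := ⟨0, by simp [h]⟩

lemma Linked.symm (h : Linked ι x y) : Linked ι y x := by
  obtain ⟨v, hv⟩ := h
  exact ⟨-v, by simp [hv]⟩

lemma Linked.trans (h : Linked ι x y) (h' : Linked ι y z) : Linked ι x z := by
  obtain ⟨v, hv⟩ := h
  obtain ⟨w, hw⟩ := h'
  exact ⟨v + w, by simp [hw, hv, add_assoc]⟩

namespace IsCoord

variable {E : Set (G × G)} {φ : G → G → G} {a b : ZMod p} {ℓ : ℕ} (hc : IsCoord E φ a b ι ℓ)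
include hc

lemma iterate_shift (k : ℕ) (v : ℤ → ZMod p) : ι (shiftMap^[k] v) = shiftMap^[k] (ι v) := by
  induction k generalizing v with
  | zero => rfl
  | succ k ih => rw [Function.iterate_succ_apply, ih, hc.shift, Function.iterate_succ_apply]

lemma congr {v w : ℤ → ZMod p} {n : ℤ} (h : ∀ i, n - ℓ ≤ i → i < n → v i = w i) :
    ι v n = ι w n := by
  rw [← sub_eq_zero, ← Pi.sub_apply, ← map_sub]
  exact hc.eq_zero _ _ fun i h1 h2 => by simp [h i h1 h2]

lemma CA_iterate_add (n : ℕ) (x : ℤ → G) (v : ℤ → ZMod p) :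
    (CA φ)^[n] (x + ι v) = (CA φ)^[n] x + ι ((linCA a b ^ n) v) := by
  induction n generalizing x v with
  | zero => simp
  | succ n ih =>
    rw [Function.iterate_succ_apply, hc.CA_add, ih, ← pow_succ_apply_eq,
      Function.iterate_succ_apply]

lemma linked_cover (hx : x ∈ TMC E) (hy : y ∈ TMC E) (h : Linked ι x y) (M : ℕ) :
    ∃ v, ∀ n : ℤ, 0 ≤ n → n ≤ M → y n = x n + ι v n := by
  obtain ⟨v, hv⟩ := h
  simpa using hc.cover x hx y hy v 0 hv M

lemma linked_shift (hx : x ∈ TMC E) (hy : y ∈ TMC E) (h : Linked ι x y) (k : ℕ) :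
    Linked ι (shiftMap^[k] x) (shiftMap^[k] y) := by
  obtain ⟨v, hv⟩ := hc.linked_cover hx hy h k
  refine ⟨shiftMap^[k] v, ?_⟩
  rw [hc.iterate_shift]
  simp only [iterate_shiftMap_apply, zero_add]
  exact hv _ (by simp) le_rfl

lemma linked_CA (hx : x ∈ TMC E) (hy : y ∈ TMC E) (h : Linked ι x y) :
    Linked ι (CA φ x) (CA φ y) := by
  obtain ⟨v, hv⟩ := hc.linked_cover hx hy h 1
  refine ⟨linCA a b v, ?_⟩
  rw [← Pi.add_apply, ← hc.CA_add]
  simp only [CA, Pi.add_apply]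
  rw [hv 0 le_rfl (by simp), hv (0 + 1) (by simp) (by simp)]

lemma exists_linked (hirr : IrreducibleTMC E) (hx : x ∈ TMC E) (y : ℤ → G) :
    ∃ k : ℕ, 1 ≤ k ∧ Linked ι (shiftMap^[k] x) y := by
  obtain ⟨z, hz, i, j, hij, hzi, hzj⟩ := hirr (x 0) (y 0)
  have h1 : Linked ι x (fun n => z (n + i)) := Linked.of_eq (by simp [hzi])
  refine ⟨(j - i).toNat, by omega, (hc.linked_shift hx (mem_TMC_shift hz i) h1 _).trans
    (Linked.of_eq ?_)⟩
  rw [iterate_shiftMap_apply, ← hzj]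
  congr 1
  omega

lemma exists_period (hirr : IrreducibleTMC E) :
    ∃ q : ℕ, 1 ≤ q ∧ ∀ x ∈ TMC E, Linked ι (shiftMap^[q] x) x := by
  by_cases h : ∃ x, x ∈ TMC E
  · obtain ⟨x, hx⟩ := h
    obtain ⟨q, hq, hqx⟩ := hc.exists_linked hirr hx x
    refine ⟨q, hq, fun y hy => ?_⟩
    obtain ⟨t, -, ht⟩ := hc.exists_linked hirr hx y
    have h1 := hc.linked_shift (mem_TMC_iterate hx t) hy ht q
    have h2 := hc.linked_shift (mem_TMC_iterate hx q) hx hqx t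
    rw [← Function.iterate_add_apply, add_comm, Function.iterate_add_apply] at h1
    exact (h1.symm.trans h2).trans ht
  · push Not at h
    exact ⟨1, le_rfl, fun x hx => absurd hx (h x)⟩

lemma linked_of_linked_shift (hirr : IrreducibleTMC E) (hx : x ∈ TMC E) (hy : y ∈ TMC E)
    (h : Linked ι (shiftMap x) (shiftMap y)) : Linked ι x y := by
  obtain ⟨q, hq, hqx⟩ := hc.exists_period hirr
  have h1 := hc.linked_shift (mem_TMC_iterate hx 1) (mem_TMC_iterate hy 1) h (q - 1)
  simp only [← Function.iterate_add_apply, Nat.sub_add_cancel hq] at h1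
  exact ((hqx x hx).symm.trans h1).trans (hqx y hy)

lemma linked_of_CA_eq (hirr : IrreducibleTMC E) (hx : x ∈ TMC E) (hy : y ∈ TMC E)
    (h : CA φ x = CA φ y) : Linked ι x y := by
  obtain ⟨k, -, hk⟩ := hc.exists_linked hirr hx y
  have h1 := hc.linked_CA (mem_TMC_iterate hx k) hy hk
  rw [← h, CA_iterate_shiftMap] at h1
  obtain ⟨t, -, ht⟩ := hc.exists_linked hirr (hc.CA_mem x hx) x
  have h2 := hc.linked_shift (mem_TMC_iterate (hc.CA_mem x hx) t) hx ht k
  have h3 := hc.linked_shift (mem_TMC_iterate (hc.CA_mem x hx) k) (hc.CA_mem x hx) h1 t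
  rw [← Function.iterate_add_apply, add_comm, Function.iterate_add_apply] at h2
  exact ((h2.symm.trans h3).trans ht).symm.trans hk

variable [Fact p.Prime]

lemma exists_ker_of_CA_eq (hirr : IrreducibleTMC E) (hx : x ∈ TMC E) (hy : y ∈ TMC E)
    (h : CA φ x = CA φ y) : ∃ e, linCA a b e = 0 ∧ y = x + ι e := by
  obtain ⟨v, hv⟩ := hc.linked_cover hx hy (hc.linked_of_CA_eq hirr hx hy h) (ℓ + 2)
  push_cast at hv
  have h1 : ∀ n : ℤ, 0 ≤ n → n ≤ ℓ + 1 → ι (linCA a b v) n = 0 := by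
    intro n h0 hn
    have e1 : CA φ y n = CA φ (x + ι v) n := by
      simp only [CA, Pi.add_apply]
      rw [hv n h0 (by omega), hv (n + 1) (by omega) (by omega)]
    rw [hc.CA_add, ← h, Pi.add_apply, left_eq_add] at e1
    exact e1
  obtain ⟨e, he, he0⟩ := exists_linCA_eq hc.a_ne hc.b_ne 0 0 (v 0)
  have h2 := eq_on_window_of_linCA_eq hc.b_ne (d := e) (d' := v) (s := 0) (j := ℓ) he0
    fun i hi hi' => by
      rw [hc.apply_eq_zero _ i (h1 i hi (by omega)) (h1 _ (by omega) (by omega)), he]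
      rfl
  refine ⟨e, he, hc.eq_of_CA_eq y (x + ι e) ℓ ?_ ?_⟩
  · rw [hc.CA_add, he, map_zero, add_zero, h]
  · rw [hv _ (by simp) (by omega), Pi.add_apply]
    congr 1
    exact hc.congr fun i hi hi' => (h2 i (by omega) (by omega)).symm

lemma exists_ker_pow_of_CA_eq (hirr : IrreducibleTMC E) (n : ℕ) (hx : x ∈ TMC E)
    (hy : y ∈ TMC E) (h : (CA φ)^[n] x = (CA φ)^[n] y) :
    ∃ e, (linCA a b ^ n) e = 0 ∧ y = x + ι e := by
  induction n generalizing x y with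
  | zero => exact ⟨0, by simp, by simpa using h.symm⟩
  | succ n ih =>
    obtain ⟨v, hv, hyv⟩ := ih (hc.CA_mem x hx) (hc.CA_mem y hy) h
    obtain ⟨u, rfl⟩ := linCA_surjective hc.a_ne hc.b_ne v
    rw [← hc.CA_add] at hyv
    obtain ⟨e, he, hye⟩ := hc.exists_ker_of_CA_eq hirr (hc.add_mem x hx u) hy hyv.symm
    refine ⟨u + e, ?_, ?_⟩
    · rw [map_add, pow_succ_apply_eq, hv, pow_succ_apply_eq, he, map_zero, add_zero]
    · rw [hye, map_add, add_assoc]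

end IsCoord

end Linked

section InvariantSets

variable {X : Type*} {T : X → X}

/-- The left shift on one-sided sequences. -/
def tailMap {A : Type*} (v : ℕ → A) : ℕ → A := fun i => v (i + 1)

lemma tailMap_iterate_apply {A : Type*} (v : ℕ → A) (n i : ℕ) : tailMap^[n] v i = v (i + n) := by
  induction n generalizing v with
  | zero => rfl
  | succ n ih => rw [Function.iterate_succ_apply, ih]; exact congrArg v (by ring)

/-- The itinerary of `x` with respect to `s`. -/
def itinerary (T : X → X) (s : Set X) (x : X) : ℕ → Prop := fun i => T^[i] x ∈ s

lemma itinerary_iterate (s : Set X) (n : ℕ) (x : X) :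
    itinerary T s (T^[n] x) = tailMap^[n] (itinerary T s x) := by
  ext i
  rw [tailMap_iterate_apply, itinerary, itinerary, Function.iterate_add_apply]

lemma finite_periodic_tailMap {A : Type*} [Finite A] {N : ℕ} (hN : 0 < N) :
    {w : ℕ → A | Function.IsPeriodicPt tailMap N w}.Finite := by
  refine Set.Finite.of_injOn (f := fun w (i : Fin N) => w i) (t := Set.univ)
    (fun _ _ => Set.mem_univ _) (fun w hw w' hw' h => ?_) Set.finite_univ
  have per : ∀ w : ℕ → A, Function.IsPeriodicPt tailMap N w → Function.Periodic w N :=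
    fun w hw i => by
      have := congrFun hw i
      rwa [tailMap_iterate_apply] at this
  ext i
  rw [← (per w hw).map_mod_nat, ← (per w' hw').map_mod_nat]
  exact congrFun h ⟨i % N, Nat.mod_lt _ hN⟩

variable [MeasurableSpace X] {μ : Measure X}

lemma measurable_itinerary (hT : Measurable T) {s : Set X} (hs : MeasurableSet s) :
    Measurable (itinerary T s) :=
  measurable_pi_lambda _ fun i => measurable_to_prop (by
    simpa [Set.preimage, itinerary] using (hT.iterate i) hs)

lemma measure_itinerary_eq_zero (hT : Measurable T) {M N : ℕ} (hN : 0 < N)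
    (hMN : ∀ ℓ, ℓ.Prime → ℓ ∣ N → ℓ ∣ M)
    (hM : ∀ s, MeasurableSet s → T^[M] ⁻¹' s = s → T ⁻¹' s =ᵐ[μ] s)
    {s : Set X} (hs : MeasurableSet s) {w : ℕ → Prop} (hw : Function.IsPeriodicPt tailMap N w)
    (hw1 : tailMap w ≠ w) : μ (itinerary T s ⁻¹' {w}) = 0 := by
  obtain ⟨ℓ, hℓ, e, he⟩ := Nat.exists_prime_and_dvd (n := Function.minimalPeriod tailMap w)
    (fun h => hw1 (Function.minimalPeriod_eq_one_iff_isFixedPt.1 h))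
  have hd0 := hw.minimalPeriod_pos hN
  have he0 : 0 < e := Nat.pos_of_ne_zero fun h => by simp [h] at he; omega
  have hdN := hw.minimalPeriod_dvd
  have hℓM : ℓ ∣ M := hMN ℓ hℓ ((Dvd.intro _ he.symm).trans hdN)
  let U : Set X := itinerary T s ⁻¹' {v | ∃ j, tailMap^[ℓ * j] v = w}
  have htail : Measurable (tailMap : (ℕ → Prop) → ℕ → Prop) :=
    measurable_pi_lambda _ fun i => measurable_pi_apply _
  have hU : MeasurableSet U := by
    refine measurable_itinerary hT hs ?_
    rw [Set.ofPred_exists]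
    exact MeasurableSet.iUnion fun j => htail.iterate _ (measurableSet_singleton w)
  have hTU : T^[ℓ] ⁻¹' U = U := by
    ext x
    simp only [U, Set.mem_preimage, Set.mem_ofPred_eq, itinerary_iterate]
    constructor
    · rintro ⟨j, hj⟩
      exact ⟨j + 1, by rw [mul_add, mul_one, Function.iterate_add_apply, hj]⟩
    · rintro ⟨j, hj⟩
      refine ⟨j + e - 1, ?_⟩
      rw [← Function.iterate_add_apply, ← mul_add_one,
        show j + e - 1 + 1 = e + j by omega, mul_add, Function.iterate_add_apply, hj, ← he,
        Function.iterate_minimalPeriod]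
  have hTMU : T^[M] ⁻¹' U = U := by
    obtain ⟨k, rfl⟩ := hℓM
    rw [Function.iterate_mul, Set.preimage_iterate_eq]
    exact Function.iterate_fixed hTU k
  have h1 := hM U hU hTMU
  have h2 : T ⁻¹' U ∩ U = ∅ := by
    ext x
    simp only [Set.mem_inter_iff, Set.mem_empty_iff_false, iff_false, U, Set.mem_preimage,
      Set.mem_ofPred_eq]
    rintro ⟨⟨j, hj⟩, ⟨i, hi⟩⟩
    have h3 := itinerary_iterate (T := T) s 1 x
    rw [Function.iterate_one, Function.iterate_one] at h3
    rw [h3, ← Function.iterate_succ_apply] at hj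
    have h4 : tailMap^[ℓ * j + 1] w = tailMap^[ℓ * i] w := by
      conv_lhs => rw [← hi, ← Function.iterate_add_apply, add_comm, Function.iterate_add_apply]
      rw [hj]
    rw [← Function.iterate_mod_minimalPeriod_eq (n := ℓ * i),
      ← Function.iterate_mod_minimalPeriod_eq (n := ℓ * j + 1)] at h4
    have h5 : ℓ * j + 1 ≡ ℓ * i [MOD Function.minimalPeriod tailMap w] :=
      Function.iterate_injOn_Iio_minimalPeriod (Nat.mod_lt _ hd0) (Nat.mod_lt _ hd0) h4
    have h6 : ℓ * j + 1 ≡ ℓ * i [MOD ℓ] := h5.of_dvd (Dvd.intro _ he.symm)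
    have h7 : (ℓ * j + 1) % ℓ = (ℓ * i) % ℓ := h6
    rw [Nat.mul_mod_right, Nat.mul_add_mod, Nat.mod_eq_of_lt hℓ.one_lt] at h7
    exact one_ne_zero h7
  have h3 : μ U = 0 := by
    have : (T ⁻¹' U ∩ U : Set X) =ᵐ[μ] (U ∩ U : Set X) := h1.inter (ae_eq_refl _)
    rw [h2, Set.inter_self] at this
    rw [← measure_congr this, measure_empty]
  have h4 : itinerary T s ⁻¹' {w} ⊆ U := fun x hx => ⟨0, hx⟩
  exact measure_mono_null h4 h3

/-- If sets invariant under `T^M` are almost invariant under `T`, the same holds for every `N`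
all of whose prime factors divide `M`. -/
lemma preimage_ae_eq_of_iterate (hT : Measurable T) {M N : ℕ} (hN : 0 < N)
    (hMN : ∀ ℓ, ℓ.Prime → ℓ ∣ N → ℓ ∣ M)
    (hM : ∀ s, MeasurableSet s → T^[M] ⁻¹' s = s → T ⁻¹' s =ᵐ[μ] s)
    {s : Set X} (hs : MeasurableSet s) (hTs : T^[N] ⁻¹' s = s) : T ⁻¹' s =ᵐ[μ] s := by
  have hper : ∀ x, Function.IsPeriodicPt tailMap N (itinerary T s x) := by
    intro x
    ext i
    rw [← itinerary_iterate, itinerary, itinerary, ← Function.iterate_add_apply, add_comm,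
      Function.iterate_add_apply]
    change T^[i] x ∈ T^[N] ⁻¹' s ↔ _
    rw [hTs]
  have hnull : μ (⋃ w ∈ {w : ℕ → Prop | Function.IsPeriodicPt tailMap N w ∧ tailMap w ≠ w},
      itinerary T s ⁻¹' {w}) = 0 := by
    refine (measure_biUnion_null_iff ?_).2 fun w hw =>
      measure_itinerary_eq_zero hT hN hMN hM hs hw.1 hw.2
    exact ((finite_periodic_tailMap hN).subset fun w hw => hw.1).countable
  filter_upwards [measure_eq_zero_iff_ae_notMem.1 hnull] with x hx
  simp only [Set.mem_iUnion, not_exists] at hx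
  have h1 := hx (itinerary T s x)
  by_contra h
  refine h1 ⟨hper x, fun h2 => h ?_⟩ rfl
  exact congrFun h2 0

lemma comp_ae_eq_of_iterate {Y : Type*} [MeasurableSpace Y]
    [MeasurableSpace.CountablySeparated Y] (hT : MeasurePreserving T μ μ) {N : ℕ}
    (hN : ∀ s, MeasurableSet s → T^[N] ⁻¹' s = s → T ⁻¹' s =ᵐ[μ] s) {f : X → Y}
    (hf : Measurable f) (hfN : f ∘ T^[N] =ᵐ[μ] f) : f ∘ T =ᵐ[μ] f := by
  refine Filter.EventuallyEq.of_forall_separating_preimage MeasurableSet fun U hU => ?_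
  have h1 : T^[N] ⁻¹' (f ⁻¹' U) =ᵐ[μ] f ⁻¹' U := by
    filter_upwards [hfN] with x hx
    change (f (T^[N] x) ∈ U) = (f x ∈ U)
    rw [← hx]; rfl
  obtain ⟨t, ht, htU, hTt⟩ :=
    (hT.iterate N).quasiMeasurePreserving.exists_preimage_eq_of_preimage_ae
      (hf hU).nullMeasurableSet h1
  have h2 := hT.quasiMeasurePreserving.preimage_ae_eq htU
  exact h2.symm.trans ((hN t ht hTt).trans htU)

end InvariantSets

lemma shiftMap_injective {A : Type*} : Function.Injective (shiftMap : (ℤ → A) → ℤ → A) :=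
  fun x y h => funext fun i => by simpa [shiftMap] using congrFun h (i - 1)

lemma measurable_shiftMap {A : Type*} [MeasurableSpace A] :
    Measurable (shiftMap : (ℤ → A) → ℤ → A) :=
  measurable_pi_lambda _ fun i => measurable_pi_apply (i + 1)

section Kernel

variable {p : ℕ} [Fact p.Prime] {a b : ZMod p}

lemma shiftMap_mem_ker {n : ℕ} {d : ℤ → ZMod p} (hd : (linCA a b ^ n) d = 0) :
    (linCA a b ^ n) (shiftMap d) = 0 := by
  have h := LinearMap.congr_fun ((commute_shiftLin_linCA a b).pow_right n).eq d
  simp only [Module.End.mul_apply, shiftLin_apply, hd] at h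
  exact h.symm

lemma shiftMap_ker_bijective (ha : a ≠ 0) (hb : b ≠ 0) (n : ℕ) :
    Function.Bijective fun d : LinearMap.ker (linCA a b ^ n) =>
      (⟨shiftMap d, shiftMap_mem_ker d.2⟩ : LinearMap.ker (linCA a b ^ n)) := by
  have := finite_ker_pow ha hb n
  rw [← Finite.injective_iff_bijective]
  exact fun d d' h => Subtype.ext (shiftMap_injective (Subtype.mk.inj h))

lemma exists_shiftMap_eq (ha : a ≠ 0) (hb : b ≠ 0) {n : ℕ} {d : ℤ → ZMod p}
    (hd : (linCA a b ^ n) d = 0) : ∃ d', (linCA a b ^ n) d' = 0 ∧ shiftMap d' = d := by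
  obtain ⟨d', h⟩ := (shiftMap_ker_bijective ha hb n).2 ⟨d, hd⟩
  exact ⟨d', d'.2, congrArg Subtype.val h⟩

/-- A function on the kernel of `linCA a b ^ n` that is shift-invariant around each point of its
support is either supported in, or invariant under, the kernel of `linCA a b ^ j`. -/
lemma ker_support_dichotomy (ha : a ≠ 0) (hb : b ≠ 0) (u : (ℤ → ZMod p) → ℝ≥0∞) {n j : ℕ}
    (h0 : u 0 ≠ 0)
    (hu : ∀ d, (linCA a b ^ n) d = 0 → u d ≠ 0 → ∀ e, (linCA a b ^ n) e = 0 →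
      u (d + shiftMap e) = u (d + e)) :
    (∀ d, (linCA a b ^ n) d = 0 → u d ≠ 0 → (linCA a b ^ j) d = 0) ∨
      ∀ d, (linCA a b ^ j) d = 0 → ∀ e, (linCA a b ^ n) e = 0 → u (e + d) = u e := by
  have hu0 : ∀ e, (linCA a b ^ n) e = 0 → u (shiftMap e) = u e := fun e he => by
    simpa using hu 0 (map_zero _) h0 e he
  let K : AddSubgroup (ℤ → ZMod p) :=
    { carrier := {k | (linCA a b ^ n) k = 0 ∧ ∀ e, (linCA a b ^ n) e = 0 → u (e + k) = u e}
      zero_mem' := ⟨map_zero _, fun e _ => by rw [add_zero]⟩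
      add_mem' := fun {k k'} hk hk' => ⟨by rw [map_add, hk.1, hk'.1, add_zero], fun e he => by
        rw [← add_assoc, hk'.2 _ (by rw [map_add, he, hk.1, add_zero]), hk.2 e he]⟩
      neg_mem' := fun {k} hk => ⟨by rw [map_neg, hk.1, neg_zero], fun e he => by
        rw [← hk.2 (e + -k) (by rw [map_add, map_neg, he, hk.1, neg_zero, add_zero]),
          neg_add_cancel_right]⟩ }
  have hK : ∀ k ∈ K, shiftMap k ∈ K := by
    rintro k ⟨hk, hk'⟩
    refine ⟨shiftMap_mem_ker hk, fun e he => ?_⟩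
    obtain ⟨f, hf, rfl⟩ := exists_shiftMap_eq ha hb he
    rw [hu0 f hf, ← hk' f hf, ← hu0 (f + k) (by rw [map_add, hf, hk, add_zero])]
    rfl
  by_cases h : ∀ d, (linCA a b ^ n) d = 0 → u d ≠ 0 → (linCA a b ^ j) d = 0
  · exact Or.inl h
  · push Not at h
    obtain ⟨d, hd, hud, hdj⟩ := h
    refine Or.inr fun e he => (ker_le_of_shift_sub_mem ha hb K hK ?_ hd hdj e he).2
    refine ⟨by rw [map_sub, shiftMap_mem_ker hd, hd, sub_zero], fun e he => ?_⟩
    obtain ⟨e', he', h⟩ := exists_shiftMap_eq ha hb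
      (show (linCA a b ^ n) (e - d) = 0 by rw [map_sub, he, hd, sub_zero])
    have h1 := hu d hd hud e' he'
    rw [h, add_sub_cancel] at h1
    rw [h1, ← hu0 (d + e') (by rw [map_add, hd, he', add_zero])]
    congr 1
    have : e = shiftMap e' + d := by rw [h, sub_add_cancel]
    rw [this]
    change _ = shiftMap d + shiftMap e'
    abel

end Kernel

section Averaging

variable {G : Type*} [AddCommGroup G] [Finite G] [MeasurableSpace G] [MeasurableSingletonClass G]

lemma measurable_add_const_pi (g : ℤ → G) : Measurable fun x : ℤ → G => x + g :=
  measurable_pi_lambda _ fun i =>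
    (Measurable.of_discrete (f := fun y : G => y + g i)).comp (measurable_pi_apply i)

variable {p : ℕ} [Fact p.Prime] {E : Set (G × G)} {φ : G → G → G} {a b : ZMod p}
  {ι : (ℤ → ZMod p) →+ (ℤ → G)} {ℓ : ℕ} (hc : IsCoord E φ a b ι ℓ)
  {μ : Measure (ℤ → G)} [IsProbabilityMeasure μ]
include hc

lemma IsCoord.exists_average (hσ : MeasurePreserving shiftMap μ μ) (n : ℕ) :
    ∃ ν : Measure (ℤ → G), IsFiniteMeasure ν ∧ μ ≪ ν ∧ MeasurePreserving shiftMap ν ν ∧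
      ∀ d, (linCA a b ^ n) d = 0 → MeasurePreserving (fun x => x + ι d) ν ν := by
  classical
  have := finite_ker_pow hc.a_ne hc.b_ne n
  have := Fintype.ofFinite (LinearMap.ker (linCA a b ^ n))
  let ν : Measure (ℤ → G) :=
    ∑ d : LinearMap.ker (linCA a b ^ n), μ.map (fun x => x + ι d)
  refine ⟨ν, ?_, ?_, ⟨measurable_shiftMap, ?_⟩, fun d hd => ⟨measurable_add_const_pi _, ?_⟩⟩
  · have : ∀ d : LinearMap.ker (linCA a b ^ n), IsFiniteMeasure (μ.map (fun x => x + ι d)) :=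
      fun d => inferInstance
    exact inferInstance
  · refine Measure.AbsolutelyContinuous.mk fun s hs h => ?_
    rw [Measure.finsetSum_apply] at h
    have := (Finset.sum_eq_zero_iff.1 h) 0 (Finset.mem_univ _)
    simpa using this
  · rw [Measure.map_finset_sum measurable_shiftMap.aemeasurable]
    refine Eq.trans ?_ ((shiftMap_ker_bijective hc.a_ne hc.b_ne n).sum_comp
      fun d : LinearMap.ker (linCA a b ^ n) => μ.map (fun x => x + ι d))
    refine Finset.sum_congr rfl fun d _ => ?_
    rw [Measure.map_map measurable_shiftMap (measurable_add_const_pi _)]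
    conv_rhs => rw [← hσ.map_eq, Measure.map_map (measurable_add_const_pi _) measurable_shiftMap]
    congr 1
    ext1 x
    simp only [Function.comp_apply, hc.shift]
    rfl
  · rw [Measure.map_finset_sum (measurable_add_const_pi _).aemeasurable]
    refine Eq.trans ?_ ((Equiv.addRight
      (⟨d, hd⟩ : LinearMap.ker (linCA a b ^ n))).bijective.sum_comp
      fun d : LinearMap.ker (linCA a b ^ n) => μ.map (fun x => x + ι d))
    refine Finset.sum_congr rfl fun e _ => ?_
    rw [Measure.map_map (measurable_add_const_pi _) (measurable_add_const_pi _)]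
    congr 1
    ext1 x
    simp [add_assoc]

/-- The density of `μ` with respect to its average over the kernel of `linCA a b ^ n` is almost
surely shift-invariant along the kernel. -/
lemma IsCoord.exists_density (hσ : MeasurePreserving shiftMap μ μ) {n N : ℕ}
    (hper : ∀ d, (linCA a b ^ n) d = 0 → shiftMap^[N] d = d)
    (hN : ∀ s, MeasurableSet s → shiftMap^[N] ⁻¹' s = s → shiftMap ⁻¹' s =ᵐ[μ] s) :
    ∃ (ν : Measure (ℤ → G)) (f : (ℤ → G) → ℝ≥0∞), Measurable f ∧ μ = ν.withDensity f ∧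
      (∀ d, (linCA a b ^ n) d = 0 → MeasurePreserving (fun x => x + ι d) ν ν) ∧
      ∀ᵐ x ∂μ, f x ≠ 0 ∧ ∀ d, (linCA a b ^ n) d = 0 → f (x + ι d) ≠ 0 →
        ∀ e, (linCA a b ^ n) e = 0 → f (x + ι (d + shiftMap e)) = f (x + ι (d + e)) := by
  have hfin : Finite (LinearMap.ker (linCA a b ^ n)) := finite_ker_pow hc.a_ne hc.b_ne n
  have hcount : {d | (linCA a b ^ n) d = 0}.Countable := Set.Finite.countable hfin
  obtain ⟨ν, hν, hμν, hνσ, hντ⟩ := hc.exists_average hσ n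
  let f := μ.rnDeriv ν
  have hf : Measurable f := Measure.measurable_rnDeriv μ ν
  have hμf : ν.withDensity f = μ := Measure.withDensity_rnDeriv_eq μ ν hμν
  have hfσ : f ∘ shiftMap =ᵐ[ν] f := hσ.rnDeriv_comp_aeEq hνσ
  have hfN : f ∘ shiftMap^[N] =ᵐ[ν] f := hσ.iterate N |>.rnDeriv_comp_aeEq (hνσ.iterate N)
  have good : ∀ᵐ x ∂μ, ∀ d ∈ {d | (linCA a b ^ n) d = 0},
      f (x + ι (shiftMap d)) = f (x + ι d) := by
    refine (ae_ball_iff hcount).2 fun d hd => ?_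
    have hd' := shiftMap_mem_ker hd
    have h1 : (fun x => f (x + ι (shiftMap d))) ∘ shiftMap^[N] =ᵐ[μ]
        fun x => f (x + ι (shiftMap d)) := by
      filter_upwards [hμν.ae_le ((hντ _ hd').quasiMeasurePreserving.ae hfN)] with x hx
      rw [Function.comp_apply] at hx ⊢
      rw [← hx]
      congr 1
      conv_lhs => rw [← hper _ hd', hc.iterate_shift]
      ext i
      simp [iterate_shiftMap_apply]
    have h2 := comp_ae_eq_of_iterate hσ hN (hf.comp (measurable_add_const_pi _)) h1
    filter_upwards [h2, hμν.ae_le ((hντ _ hd).quasiMeasurePreserving.ae hfσ)] with x h3 h4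
    simp only [Function.comp_apply] at h3 h4
    rw [← h3, ← h4, hc.shift]
    rfl
  refine ⟨ν, f, hf, hμf.symm, hντ, ?_⟩
  have good' : ∀ᵐ x ∂ν, f x ≠ 0 → ∀ d ∈ {d | (linCA a b ^ n) d = 0},
      f (x + ι (shiftMap d)) = f (x + ι d) := by
    rw [← ae_withDensity_iff hf, hμf]
    exact good
  have good'' : ∀ᵐ x ∂ν, ∀ d ∈ {d | (linCA a b ^ n) d = 0}, f (x + ι d) ≠ 0 →
      ∀ e ∈ {d | (linCA a b ^ n) d = 0},
      f (x + ι d + ι (shiftMap e)) = f (x + ι d + ι e) :=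
    (ae_ball_iff hcount).2 fun d hd => (hντ d hd).quasiMeasurePreserving.ae good'
  filter_upwards [hμν.ae_le good'', Measure.rnDeriv_pos hμν] with x hx hx0
  refine ⟨hx0.ne', fun d hd hxd e he => ?_⟩
  rw [map_add, map_add, ← add_assoc, ← add_assoc]
  exact hx d hd hxd e he

omit hc [IsProbabilityMeasure μ] in
lemma measure_inter_eq_of_density {ν : Measure (ℤ → G)} {f : (ℤ → G) → ℝ≥0∞}
    (hf : Measurable f) (hμ : μ = ν.withDensity f) {d : ℤ → ZMod p}
    (hd : MeasurePreserving (fun x => x + ι d) ν ν) {B : Set (ℤ → G)} (hB : MeasurableSet B)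
    (hBd : ∀ x, x + ι d ∈ B ↔ x ∈ B) (hBf : ∀ x ∈ B, f (x + ι d) = f x)
    {S : Set (ℤ → G)} (hS : MeasurableSet S) :
    μ (B ∩ (fun x => x + ι d) ⁻¹' S) = μ (B ∩ S) := by
  have hS' := measurable_add_const_pi (ι d) hS
  rw [hμ, withDensity_apply _ (hB.inter hS'), withDensity_apply _ (hB.inter hS),
    ← lintegral_indicator (hB.inter hS'), ← lintegral_indicator (hB.inter hS),
    ← hd.lintegral_comp (hf.indicator (hB.inter hS))]
  refine lintegral_congr fun x => ?_
  by_cases h : x ∈ B ∧ x + ι d ∈ S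
  · rw [Set.indicator_of_mem (show x ∈ B ∩ _ from h),
      Set.indicator_of_mem (show x + ι d ∈ B ∩ S from ⟨(hBd x).2 h.1, h.2⟩), hBf x h.1]
  · rw [Set.indicator_of_notMem (show x ∉ B ∩ _ from h),
      Set.indicator_of_notMem (show x + ι d ∉ B ∩ S from fun h' => h ⟨(hBd x).1 h'.1, h'.2⟩)]

end Averaging

lemma measurableSet_TMC {A : Type*} [Finite A] [MeasurableSpace A] [MeasurableSingletonClass A]
    (E : Set (A × A)) : MeasurableSet (TMC E) := by
  rw [TMC, Set.ofPred_forall]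
  exact MeasurableSet.iInter fun i =>
    ((measurable_pi_apply i).prodMk (measurable_pi_apply (i + 1))) (Set.toFinite E).measurableSet

lemma continuous_CA {A : Type*} [TopologicalSpace A] [DiscreteTopology A] (φ : A → A → A) :
    Continuous (CA φ) :=
  continuous_pi fun i =>
    Continuous.comp (g := fun z : A × A => φ z.1 z.2) (f := fun x : ℤ → A => (x i, x (i + 1)))
      continuous_of_discreteTopology ((continuous_apply i).prodMk (continuous_apply (i + 1)))

section Dichotomy

variable {G : Type*} [AddCommGroup G] [Finite G] [TopologicalSpace G] [DiscreteTopology G]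
  [MeasurableSpace G] [MeasurableSingletonClass G]
  {p : ℕ} [Fact p.Prime] {E : Set (G × G)} {φ : G → G → G} {a b : ZMod p}
  {ι : (ℤ → ZMod p) →+ (ℤ → G)} {ℓ : ℕ} (hc : IsCoord E φ a b ι ℓ)
  {μ : Measure (ℤ → G)} [IsProbabilityMeasure μ]
include hc

/-- If `CA φ` is uniformly non-injective with respect to `μ`, then on a set of measure bounded
below, `μ` is invariant under translation by the kernel of `linCA a b ^ j`. -/
lemma IsCoord.exists_invariant_part (hirr : IrreducibleTMC E) (hμE : ∀ᵐ x ∂μ, x ∈ TMC E)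
    (hσ : MeasurePreserving shiftMap μ μ) (hΦ : MeasurePreserving (CA φ) μ μ) {c : ℝ≥0∞}
    (hinj : ∀ Z, IsCompact Z → Set.InjOn (CA φ) Z → μ Z + c ≤ 1) {n N j : ℕ} (hj : j + 1 ≤ n)
    (hper : ∀ d, (linCA a b ^ n) d = 0 → shiftMap^[N] d = d)
    (hN : ∀ s, MeasurableSet s → shiftMap^[N] ⁻¹' s = s → shiftMap ⁻¹' s =ᵐ[μ] s) :
    ∃ B, MeasurableSet B ∧ c ≤ μ B ∧ ∀ d, (linCA a b ^ j) d = 0 →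
      ∀ S, MeasurableSet S → μ (B ∩ (fun x => x + ι d) ⁻¹' S) = μ (B ∩ S) := by
  have hcount : ∀ m, {d | (linCA a b ^ m) d = 0}.Countable := fun m =>
    have : Finite (LinearMap.ker (linCA a b ^ m)) := finite_ker_pow hc.a_ne hc.b_ne m
    Set.Finite.countable this
  have hle : ∀ {m d}, m ≤ n → (linCA a b ^ m) d = 0 → (linCA a b ^ n) d = 0 := by
    intro m d hm hd
    obtain ⟨k, rfl⟩ := Nat.exists_eq_add_of_le' hm
    rw [pow_add, Module.End.mul_apply, hd, map_zero]
  obtain ⟨ν, f, hf, hμν, hντ, hgood⟩ := hc.exists_density hσ hper hN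
  have hfd : ∀ d, Measurable fun x => f (x + ι d) := fun d => hf.comp (measurable_add_const_pi _)
  let A : Set (ℤ → G) := {x | f x ≠ 0 ∧ x ∈ TMC E ∧ ∀ d ∈ {d | (linCA a b ^ n) d = 0},
    f (x + ι d) ≠ 0 → (linCA a b ^ j) d = 0}
  let B : Set (ℤ → G) := {x | ∀ d ∈ {d | (linCA a b ^ j) d = 0},
    ∀ e ∈ {d | (linCA a b ^ n) d = 0}, f (x + ι (e + d)) = f (x + ι e)}
  have hA : MeasurableSet A := by
    have : A = {x | f x ≠ 0} ∩ (TMC E ∩ ⋂ d ∈ {d | (linCA a b ^ n) d = 0},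
        {x | f (x + ι d) ≠ 0 → (linCA a b ^ j) d = 0}) := by
      ext; simp [A]
    rw [this]
    refine MeasurableSet.inter (hf (measurableSet_singleton 0).compl)
      (MeasurableSet.inter (measurableSet_TMC E) ?_)
    refine MeasurableSet.biInter (hcount n) fun d _ => ?_
    by_cases h : (linCA a b ^ j) d = 0
    · simp [h]
    · simp only [h, imp_false, not_not]
      exact hfd d (measurableSet_singleton 0)
  have hB : MeasurableSet B := by
    have : B = ⋂ d ∈ {d | (linCA a b ^ j) d = 0}, ⋂ e ∈ {d | (linCA a b ^ n) d = 0},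
        {x | f (x + ι (e + d)) = f (x + ι e)} := by
      ext; simp [B]
    rw [this]
    exact MeasurableSet.biInter (hcount j) fun d _ => MeasurableSet.biInter (hcount n) fun e _ =>
      measurableSet_eq_fun (hfd _) (hfd _)
  have hAB : ∀ᵐ x ∂μ, x ∈ A ∪ B := by
    filter_upwards [hgood, hμE] with x hx hxE
    have h0 : f (x + ι 0) ≠ 0 := by simpa using hx.1
    rcases ker_support_dichotomy hc.a_ne hc.b_ne (fun d => f (x + ι d)) (j := j) h0 hx.2 with h | h
    · exact Or.inl ⟨hx.1, hxE, h⟩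
    · exact Or.inr h
  have hμA : μ A + c ≤ 1 := by
    by_contra! h
    have h1 : 1 - c < μ A := by
      refine ENNReal.sub_lt_of_lt_add ?_ h
      simpa using hinj ∅ isCompact_empty (Set.injOn_empty _)
    rw [hA.measure_eq_iSup_isCompact_of_ne_top (measure_ne_top _ _)] at h1
    simp only [lt_iSup_iff] at h1
    obtain ⟨K, hKA, hK, h2⟩ := h1
    have hcont := (continuous_CA φ).iterate j
    have h3 := hinj _ (hK.image hcont) ?_
    · have h4 : μ K ≤ μ ((CA φ)^[j] '' K) := by
        rw [← (hΦ.iterate j).measure_preimage (hK.image hcont).measurableSet.nullMeasurableSet]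
        exact measure_mono (Set.subset_preimage_image _ _)
      have h5 := (add_le_add_left h4 c).trans h3
      exact absurd (ENNReal.le_sub_of_add_le_right (ne_top_of_le_ne_top ENNReal.one_ne_top
        (le_add_self.trans h3)) h5) (not_le.2 h2)
    · rintro _ ⟨x, hx, rfl⟩ _ ⟨y, hy, rfl⟩ hxy
      have hxy' : (CA φ)^[j + 1] x = (CA φ)^[j + 1] y := by
        rw [Function.iterate_succ_apply', Function.iterate_succ_apply', hxy]
      obtain ⟨e, he, rfl⟩ := hc.exists_ker_pow_of_CA_eq hirr (j + 1) (hKA hx).2.1 (hKA hy).2.1 hxy'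
      rw [hc.CA_iterate_add, (hKA hx).2.2 e (hle hj he) (hKA hy).1, map_zero, add_zero]
  refine ⟨B, hB, ?_, fun d hd S hS => ?_⟩
  · have h1 : 1 ≤ μ A + μ B := by
      rw [← (prob_compl_eq_zero_iff (hA.union hB)).1 hAB]
      exact measure_union_le _ _
    exact (ENNReal.add_le_add_iff_left (measure_ne_top μ A)).1 (hμA.trans h1)
  · have hdn := hle (by omega) hd
    have key : ∀ d, (linCA a b ^ n) d = 0 → ∀ x ∈ B, x + ι d ∈ B := fun d hd x hx d' hd' e he => by
      have := hx d' hd' (d + e)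
        (show (linCA a b ^ n) (d + e) = 0 by rw [map_add, hd, show (linCA a b ^ n) e = 0 from he,
          add_zero])
      rwa [add_assoc, map_add, map_add ι d e, ← add_assoc, ← add_assoc] at this
    refine measure_inter_eq_of_density hf hμν (hντ d hdn) hB (fun x => ⟨fun h => ?_, key d hdn x⟩)
      (fun x hx => ?_) hS
    · have := key (-d) (by rw [map_neg, hdn, neg_zero]) _ h
      rwa [map_neg, add_neg_cancel_right] at this
    · simpa using hx d hd 0 (map_zero _)

end Dichotomy

section Shannon

variable {Ω : Type*} [MeasurableSpace Ω]

/-- Shannon entropy of the partition into level sets of `f`. -/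
noncomputable def shannon (μ : Measure Ω) {α : Type*} [Fintype α] (f : Ω → α) : ℝ :=
  ∑ a, Real.negMulLog (μ.real (f ⁻¹' {a}))

lemma negMulLog_sum_le {β : Type*} (s : Finset β) (m : β → ℝ) (hm : ∀ b ∈ s, 0 ≤ m b) :
    Real.negMulLog (∑ b ∈ s, m b) ≤ ∑ b ∈ s, Real.negMulLog (m b) := by
  simp only [Real.negMulLog, neg_mul, Finset.sum_neg_distrib, neg_le_neg_iff, Finset.sum_mul]
  refine Finset.sum_le_sum fun b hb => ?_
  rcases (hm b hb).eq_or_lt with h | h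
  · simp [← h]
  · exact mul_le_mul_of_nonneg_left
      (Real.log_le_log h (Finset.single_le_sum (f := m) hm hb)) h.le

variable {μ : Measure Ω} [IsProbabilityMeasure μ]
  {α β : Type*} [Fintype α] [Fintype β] [MeasurableSpace α] [MeasurableSpace β]
  [MeasurableSingletonClass α] [MeasurableSingletonClass β]

omit [MeasurableSpace α] [MeasurableSingletonClass α] in
lemma shannon_le_of_factor {u : Ω → α} {v : Ω → β} (hv : Measurable v)
    (h : ∀ x y, v x = v y → u x = u y) : shannon μ u ≤ shannon μ v := by
  classical
  have : Nonempty Ω := nonempty_of_isProbabilityMeasure μ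
  have : Nonempty α := ‹Nonempty Ω›.map u
  obtain ⟨k, rfl⟩ := (Function.factorsThrough_iff u).1 (fun x y hxy => h x y hxy)
  rw [shannon, shannon, ← Finset.sum_fiberwise Finset.univ k]
  refine Finset.sum_le_sum fun a _ => ?_
  refine le_trans (le_of_eq ?_) (negMulLog_sum_le _ _ fun b _ => measureReal_nonneg)
  rw [sum_measureReal_preimage_singleton _ fun b _ => hv (measurableSet_singleton b)]
  congr 2
  ext x
  simp

lemma mul_log_sub_le {m M K : ℝ} (hm : 0 ≤ m) (hmM : m ≤ M) (hK : 0 < K) :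
    Real.negMulLog m + m * Real.log M ≤ m * Real.log K + M / K - m := by
  rcases hm.eq_or_lt with rfl | hm
  · simp only [Real.negMulLog_zero, zero_mul, add_zero, zero_add, sub_zero]
    positivity
  · have hM := hm.trans_le hmM
    have h := Real.log_le_sub_one_of_pos (show 0 < M / (m * K) by positivity)
    rw [Real.log_div hM.ne' (by positivity), Real.log_mul hm.ne' hK.ne'] at h
    have h' := mul_le_mul_of_nonneg_left h hm.le
    have : m * (M / (m * K) - 1) = M / K - m := by field_simp
    rw [this] at h'
    rw [Real.negMulLog]
    linarith

/-- Fano's inequality, in a crude form: if `f` is determined by `g` on a set `S`, then adjoining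
`f` to `g` increases the entropy only slightly. -/
lemma shannon_prod_le {f : Ω → α} {g : Ω → β} (hf : Measurable f) (hg : Measurable g)
    {S : Set Ω} {ε K : ℝ} (hS : μ.real Sᶜ ≤ ε) (h : ∀ x ∈ S, ∀ y ∈ S, g x = g y → f x = f y)
    (hK : 1 ≤ K) :
    shannon μ (fun x => (f x, g x)) ≤
      shannon μ g + (ε * (1 + Real.log K) + Fintype.card α / K) := by
  classical
  have : Nonempty Ω := nonempty_of_isProbabilityMeasure μ
  have : Nonempty α := ‹Nonempty Ω›.map f
  have hfg : Measurable fun x => (f x, g x) := hf.prodMk hg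
  obtain ⟨k, hk⟩ : ∃ k : β → α, ∀ x ∈ S, f x = k (g x) := by
    refine ⟨fun b => if hb : ∃ x ∈ S, g x = b then f hb.choose else Classical.arbitrary α,
      fun x hx => ?_⟩
    have hb : ∃ y ∈ S, g y = g x := ⟨x, hx, rfl⟩
    beta_reduce
    rw [dif_pos hb]
    exact h _ hx _ hb.choose_spec.1 hb.choose_spec.2.symm
  let m : α → β → ℝ := fun a b => μ.real ((fun x => (f x, g x)) ⁻¹' {(a, b)})
  let M : β → ℝ := fun b => μ.real (g ⁻¹' {b})
  have hm0 : ∀ a b, 0 ≤ m a b := fun a b => measureReal_nonneg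
  have hM : ∀ b, ∑ a, m a b = M b := fun b => by
    have h1 := sum_measureReal_preimage_singleton (μ := μ) (f := fun x => (f x, g x))
      (Finset.univ.map ⟨fun a : α => (a, b), fun a a' h => (Prod.ext_iff.1 h).1⟩)
      fun y _ => hfg (measurableSet_singleton y)
    rw [Finset.sum_map] at h1
    refine h1.trans ?_
    congr 1
    ext x
    simp only [Finset.coe_map, Finset.coe_univ, Set.image_univ, Set.mem_preimage, Set.mem_range,
      Set.mem_singleton_iff]
    exact ⟨fun ⟨_, h⟩ => (Prod.ext_iff.1 h).2.symm, fun h => ⟨f x, Prod.ext rfl h.symm⟩⟩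
  have hM1 : ∑ b, M b = 1 := by
    have h1 := sum_measureReal_preimage_singleton (μ := μ) (f := g) Finset.univ
      fun y _ => hg (measurableSet_singleton y)
    refine h1.trans ?_
    simp
  let e : β → ℝ := fun b => ∑ a ∈ Finset.univ.erase (k b), m a b
  have he0 : ∀ b, 0 ≤ e b := fun b => Finset.sum_nonneg fun a _ => hm0 a b
  have hMe : ∀ b, M b = m (k b) b + e b := fun b => by
    rw [← hM, ← Finset.add_sum_erase _ (fun a => m a b) (Finset.mem_univ (k b))]
  have he : ∑ b, e b ≤ ε := by
    have h1 := sum_measureReal_preimage_singleton (μ := μ) (f := fun x => (f x, g x))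
      (Finset.univ.image fun b => (k b, b)) fun y _ => hfg (measurableSet_singleton y)
    rw [Finset.sum_image (fun b _ b' _ h => (Prod.ext_iff.1 h).2)] at h1
    have h2 : ∑ b, e b = 1 - ∑ b, m (k b) b := by
      rw [← hM1, ← Finset.sum_sub_distrib]
      exact Finset.sum_congr rfl fun b _ => by rw [hMe]; ring
    rw [h2]
    change ∑ b, m (k b) b = _ at h1
    rw [h1, ← probReal_compl_eq_one_sub (hfg (Finset.measurableSet _))]
    refine le_trans (measureReal_mono (Set.compl_subset_compl.2 fun x hxS => ?_)) hS
    simp [hk x hxS]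
  have hK0 : 0 < K := by linarith
  have hb : ∀ b, ∑ a, Real.negMulLog (m a b) ≤
      Real.negMulLog (M b) + (e b * (1 + Real.log K) + Fintype.card α * (M b / K)) := by
    intro b
    have hle : ∀ a, m a b ≤ M b := fun a => by
      rw [← hM]
      exact Finset.single_le_sum (f := fun a => m a b) (fun a _ => hm0 a b) (Finset.mem_univ a)
    have hlogK := Real.log_nonneg hK
    have hMK : 0 ≤ M b / K := by have := measureReal_nonneg (μ := μ) (s := g ⁻¹' {b}); positivity
    have h1 : ∑ a, (Real.negMulLog (m a b) + m a b * Real.log (M b)) ≤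
        e b * (1 + Real.log K) + Fintype.card α * (M b / K) := by
      rw [← Finset.add_sum_erase _ _ (Finset.mem_univ (k b))]
      have h2 := mul_log_sub_le (hm0 (k b) b) (hle _) one_pos
      rw [Real.log_one, mul_zero, zero_add, div_one] at h2
      have h3 : ∑ a ∈ Finset.univ.erase (k b), (Real.negMulLog (m a b) + m a b * Real.log (M b)) ≤
          ∑ a ∈ Finset.univ.erase (k b), (m a b * Real.log K + M b / K) :=
        Finset.sum_le_sum fun a _ => by
          have := mul_log_sub_le (hm0 a b) (hle a) hK0
          linarith [hm0 a b]
      have h4 : ∑ a ∈ Finset.univ.erase (k b), (m a b * Real.log K + M b / K) ≤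
          e b * Real.log K + Fintype.card α * (M b / K) := by
        rw [Finset.sum_add_distrib, ← Finset.sum_mul, Finset.sum_const, nsmul_eq_mul]
        gcongr
        exact Finset.card_le_univ _
      linarith [hMe b]
    rw [Finset.sum_add_distrib, ← Finset.sum_mul, hM] at h1
    rw [Real.negMulLog]
    linarith
  calc shannon μ (fun x => (f x, g x)) = ∑ b, ∑ a, Real.negMulLog (m a b) := by
        rw [shannon, Fintype.sum_prod_type, Finset.sum_comm]
    _ ≤ ∑ b, (Real.negMulLog (M b) + (e b * (1 + Real.log K) + Fintype.card α * (M b / K))) :=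
        Finset.sum_le_sum fun b _ => hb b
    _ = shannon μ g + ((∑ b, e b) * (1 + Real.log K) + Fintype.card α / K) := by
        rw [Finset.sum_add_distrib, Finset.sum_add_distrib, ← Finset.sum_mul, ← Finset.mul_sum,
          ← Finset.sum_div, hM1, mul_one_div, shannon]
    _ ≤ _ := by
        have := Real.log_nonneg hK
        gcongr

lemma exists_shannon_prod_le (α : Type*) [Fintype α] [MeasurableSpace α]
    [MeasurableSingletonClass α] {δ : ℝ} (hδ : 0 < δ) :
    ∃ ε : ℝ, 0 < ε ∧ ∀ {β : Type*} [Fintype β] [MeasurableSpace β] [MeasurableSingletonClass β]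
      {f : Ω → α} {g : Ω → β}, Measurable f → Measurable g → ∀ {S : Set Ω}, μ.real Sᶜ ≤ ε →
      (∀ x ∈ S, ∀ y ∈ S, g x = g y → f x = f y) →
      shannon μ (fun x => (f x, g x)) ≤ shannon μ g + δ := by
  let K : ℝ := 1 + 2 * Fintype.card α / δ
  have hK : 1 ≤ K := by
    have : 0 ≤ 2 * Fintype.card α / δ := by positivity
    linarith
  have hl := Real.log_nonneg hK
  refine ⟨δ / 2 / (1 + Real.log K), by positivity, fun hf hg S hS h => ?_⟩
  refine (shannon_prod_le hf hg hS h hK).trans ?_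
  have h1 : δ / 2 / (1 + Real.log K) * (1 + Real.log K) = δ / 2 := by field_simp
  have h2 : Fintype.card α / K ≤ δ / 2 := by
    rw [div_le_iff₀ (by linarith)]
    have : δ / 2 * K = δ / 2 + Fintype.card α := by simp only [K]; field_simp
    linarith
  linarith

omit [IsProbabilityMeasure μ] in
lemma shannon_comp {T : Ω → Ω} (hT : MeasurePreserving T μ μ) {u : Ω → α} (hu : Measurable u) :
    shannon μ (u ∘ T) = shannon μ u := by
  refine Finset.sum_congr rfl fun a _ => ?_
  rw [Set.preimage_comp, hT.measureReal_preimage (hu (measurableSet_singleton a)).nullMeasurableSet]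

end Shannon

/-- The word of length `n` read at coordinate `s`. -/
def window {A : Type*} (s : ℤ) (n : ℕ) (x : ℤ → A) : Fin n → A := fun i => x (s + i)

lemma window_eq_iff {A : Type*} {s : ℤ} {n : ℕ} {x y : ℤ → A} :
    window s n x = window s n y ↔ ∀ i : ℤ, s ≤ i → i < s + n → x i = y i := by
  constructor
  · intro h i h1 h2
    have := congrFun h ⟨(i - s).toNat, by omega⟩
    simp only [window] at this
    rwa [show s + ((i - s).toNat : ℤ) = i by omega] at this
  · exact fun h => funext fun i => h _ (by omega) (by omega)

lemma measurable_window {A : Type*} [MeasurableSpace A] (s : ℤ) (n : ℕ) :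
    Measurable (window s n : (ℤ → A) → Fin n → A) :=
  measurable_pi_lambda _ fun _ => measurable_pi_apply _

lemma shannon_window {A : Type*} [Fintype A] [MeasurableSpace A] [MeasurableSingletonClass A]
    {μ : Measure (ℤ → A)} (hσ : MeasurePreserving shiftMap μ μ) (k n : ℕ) :
    shannon μ (window (-k) n) = shannon μ (window 0 n) := by
  rw [← shannon_comp (hσ.iterate k) (measurable_window (-k) n)]
  congr 1
  ext x i
  simp only [Function.comp_apply, window, iterate_shiftMap_apply]
  congr 1
  ring

/-- Disjoint compact sets with disjoint continuous images are separated by finitely many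
coordinates of the image. -/
lemma exists_separating_window {X A α : Type*} [TopologicalSpace X] [T2Space X] [TopologicalSpace A]
    [DiscreteTopology A] [Finite α] {Ψ : X → ℤ → A} (hΨ : Continuous Ψ) {K : α → Set X}
    (hK : ∀ i, IsCompact (K i)) (h : ∀ i j, ∀ x ∈ K i, ∀ y ∈ K j, Ψ x = Ψ y → i = j) :
    ∃ k : ℕ, ∀ i j, ∀ x ∈ K i, ∀ y ∈ K j,
      (∀ m : ℤ, -k ≤ m → m ≤ k → Ψ x m = Ψ y m) → i = j := by
  have pair : ∀ ij : α × α, ∃ k : ℕ, ∀ x ∈ K ij.1, ∀ y ∈ K ij.2,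
      (∀ m : ℤ, -k ≤ m → m ≤ k → Ψ x m = Ψ y m) → ij.1 = ij.2 := by
    rintro ⟨i, j⟩
    by_contra! hne
    let C : ℕ → Set (X × X) := fun k =>
      (K i ×ˢ K j) ∩ ⋂ m : ℤ, ⋂ (_ : -(k : ℤ) ≤ m), ⋂ (_ : m ≤ k), {z | Ψ z.1 m = Ψ z.2 m}
    have hCl : ∀ k, IsClosed (⋂ m : ℤ, ⋂ (_ : -(k : ℤ) ≤ m), ⋂ (_ : m ≤ k),
        {z : X × X | Ψ z.1 m = Ψ z.2 m}) := fun k =>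
      isClosed_iInter fun m => isClosed_iInter fun _ => isClosed_iInter fun _ =>
        isClosed_eq ((continuous_apply m).comp (hΨ.comp continuous_fst))
          ((continuous_apply m).comp (hΨ.comp continuous_snd))
    have hKK := (hK i).prod (hK j)
    obtain ⟨z, hz⟩ := IsCompact.nonempty_iInter_of_sequence_nonempty_isCompact_isClosed C
      (fun k z hz => ⟨hz.1, by
        have := hz.2
        simp only [Set.mem_iInter] at this ⊢
        exact fun m h1 h2 => this m (by push_cast; omega) (by push_cast; omega)⟩)
      (fun k => by
        obtain ⟨x, hx, y, hy, hxy, -⟩ := hne k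
        exact ⟨(x, y), ⟨hx, hy⟩, by simpa using hxy⟩)
      (hKK.inter_right (hCl 0)) fun k => hKK.isClosed.inter (hCl k)
    simp only [Set.mem_iInter] at hz
    obtain ⟨_, _, _, _, _, hij⟩ := hne 0
    refine hij (h i j z.1 (hz 0).1.1 z.2 (hz 0).1.2 (funext fun m => ?_))
    have := (hz m.natAbs).2
    simp only [Set.mem_iInter] at this
    exact this m (by omega) (by omega)
  choose k hk using pair
  obtain ⟨M, hM⟩ := Finite.exists_le k
  exact ⟨M, fun i j x hx y hy hxy => hk (i, j) x hx y hy fun m h1 h2 =>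
    hxy m (by have := hM (i, j); omega) (by have := hM (i, j); omega)⟩

section Entropy

variable {A : Type*} [Fintype A] [TopologicalSpace A] [DiscreteTopology A]
  [MeasurableSpace A] [MeasurableSingletonClass A] {μ : Measure (ℤ → A)} [IsProbabilityMeasure μ]

/-- Every measurable map to a finite set is determined by finitely many coordinates off a set of
small measure. -/
lemma exists_approx {α : Type*} [Fintype α] [MeasurableSpace α] [MeasurableSingletonClass α]
    {f : (ℤ → A) → α} (hf : Measurable f) {ε : ℝ} (hε : 0 < ε) :
    ∃ (S : Set (ℤ → A)) (k : ℕ), MeasurableSet S ∧ μ.real Sᶜ ≤ ε ∧ ∀ x ∈ S, ∀ y ∈ S,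
      (∀ m : ℤ, -k ≤ m → m ≤ k → x m = y m) → f x = f y := by
  have hδ : 0 < ε / (Fintype.card α + 1) := by positivity
  have : ∀ i, ∃ K ⊆ f ⁻¹' {i}, IsCompact K ∧ μ (f ⁻¹' {i} \ K) <
      ENNReal.ofReal (ε / (Fintype.card α + 1)) := fun i =>
    (hf (measurableSet_singleton i)).exists_isCompact_sdiff_lt (measure_ne_top _ _)
      (ENNReal.ofReal_pos.2 hδ).ne'
  choose K hKf hK hμK using this
  have hKi : ∀ i, ∀ x ∈ K i, f x = i := fun i x hx => hKf i hx
  obtain ⟨k, hk⟩ := exists_separating_window (continuous_id (X := ℤ → A)) hK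
    (fun i j x hx y hy hxy => by rw [← hKi i x hx, ← hKi j y hy]; exact congrArg f hxy)
  refine ⟨⋃ i, K i, k, MeasurableSet.iUnion fun i => (hK i).measurableSet, ?_, ?_⟩
  · have hsub : (⋃ i, K i)ᶜ ⊆ ⋃ i ∈ (Finset.univ : Finset α), (f ⁻¹' {i} \ K i) := fun x hx => by
      simp only [Set.mem_compl_iff, Set.mem_iUnion, not_exists] at hx
      simp only [Set.mem_iUnion]
      exact ⟨f x, Finset.mem_univ _, rfl, hx _⟩
    refine (measureReal_mono hsub (measure_ne_top _ _)).trans ((measureReal_biUnion_finset_le _ _).trans ?_)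
    refine (Finset.sum_le_sum fun i _ => ENNReal.toReal_le_of_le_ofReal hδ.le (hμK i).le).trans ?_
    rw [Finset.sum_const, nsmul_eq_mul, Finset.card_univ, mul_div_assoc', div_le_iff₀ (by positivity)]
    nlinarith
  · simp only [Set.mem_iUnion]
    rintro x ⟨i, hi⟩ y ⟨j, hj⟩ hxy
    rw [hKi i x hi, hKi j y hj]
    exact hk i j x hi y hj hxy

lemma eq_of_CA_eq_of_eq {A : Type*} {φ : A → A → A} (h1 : ∀ a, Function.Injective (φ a))
    (h2 : ∀ b, Function.Injective fun a => φ a b) {x y : ℤ → A} {n k : ℕ} (hk : k ≤ n)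
    (hxy : ∀ i : ℤ, 0 ≤ i → i < n → CA φ x i = CA φ y i) (hx : x k = y k) :
    ∀ i : ℤ, 0 ≤ i → i ≤ n → x i = y i := by
  have up : ∀ j : ℕ, k + j ≤ n → x (k + j) = y (k + j) := by
    intro j
    induction j with
    | zero => intro; simpa using hx
    | succ j ih =>
      intro hj
      have h := hxy (k + j) (by omega) (by omega)
      simp only [CA] at h
      rw [ih (by omega)] at h
      have := h1 _ h
      push_cast
      rwa [← add_assoc]
  have down : ∀ j : ℕ, j ≤ k → x (k - j) = y (k - j) := by
    intro j
    induction j with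
    | zero => intro; simpa using hx
    | succ j ih =>
      intro hj
      have h := hxy (k - j - 1) (by omega) (by omega)
      simp only [CA, sub_add_cancel] at h
      rw [ih (by omega)] at h
      have := h2 _ h
      push_cast
      rwa [← sub_sub]
  intro i hi hin
  rcases le_total (k : ℤ) i with h | h
  · have := up (i - k).toNat (by omega)
    rwa [show (k : ℤ) + ((i - k).toNat : ℤ) = i by omega] at this
  · have := down (k - i).toNat (by omega)
    rwa [show (k : ℤ) - ((k - i).toNat : ℤ) = i by omega] at this

variable {φ : A → A → A}

lemma exists_shannon_window_succ_le (h1 : ∀ a, Function.Injective (φ a))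
    (h2 : ∀ b, Function.Injective fun a => φ a b)
    (hσ : MeasurePreserving shiftMap μ μ) (hΦ : MeasurePreserving (CA φ) μ μ)
    (hZ : ∀ c : ℝ≥0∞, 0 < c → ∃ Z, IsCompact Z ∧ Set.InjOn (CA φ) Z ∧ 1 < μ Z + c)
    {δ : ℝ} (hδ : 0 < δ) :
    ∃ n₀ : ℕ, ∀ n ≥ n₀, shannon μ (window 0 (n + 1)) ≤ shannon μ (window 0 n) + δ := by
  obtain ⟨ε, hε, hF⟩ := exists_shannon_prod_le (μ := μ) A hδ
  obtain ⟨Z, hZc, hZi, hμZ⟩ := hZ (ENNReal.ofReal ε) (ENNReal.ofReal_pos.2 hε)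
  have hε' : μ.real Zᶜ ≤ ε := by
    refine ENNReal.toReal_le_of_le_ofReal hε.le ?_
    rw [prob_compl_eq_one_sub hZc.measurableSet]
    exact tsub_le_iff_left.2 hμZ.le
  have hcl : ∀ g, IsClosed {x : ℤ → A | x 0 = g} := fun g =>
    isClosed_eq (continuous_apply 0) continuous_const
  obtain ⟨k, hk⟩ := exists_separating_window (continuous_CA φ)
    (K := fun g => Z ∩ {x | x 0 = g}) (fun g => hZc.inter_right (hcl g))
    (fun g g' x hx y hy hxy => by
      have := hZi hx.1 hy.1 hxy
      subst this
      exact hx.2.symm.trans hy.2)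
  refine ⟨2 * k + 1, fun n hn => ?_⟩
  have hmk : Measurable fun x : ℤ → A => x k := measurable_pi_apply _
  have hmw : Measurable (window 0 n ∘ CA φ) := (measurable_window 0 n).comp hΦ.measurable
  refine (shannon_le_of_factor (hmk.prodMk hmw) fun x y hxy => ?_).trans
    ((hF hmk hmw (S := shiftMap^[k] ⁻¹' Z) ?_ ?_).trans ?_)
  · rw [Prod.mk.injEq, Function.comp_apply, Function.comp_apply, window_eq_iff] at hxy
    rw [window_eq_iff]
    intro i hi hin
    exact eq_of_CA_eq_of_eq h1 h2 (n := n) (k := k) (by omega) (fun i h h' => hxy.2 i h (by omega))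
      hxy.1 i hi (by push_cast at hin; omega)
  · rw [← Set.preimage_compl,
      (hσ.iterate k).measureReal_preimage hZc.measurableSet.compl.nullMeasurableSet]
    exact hε'
  · intro x hx y hy hxy
    rw [Function.comp_apply, Function.comp_apply, window_eq_iff] at hxy
    have := hk (shiftMap^[k] x 0) (shiftMap^[k] y 0) _ ⟨hx, rfl⟩ _ ⟨hy, rfl⟩ fun m hm hm' => by
      rw [CA_iterate_shiftMap, CA_iterate_shiftMap, iterate_shiftMap_apply,
        iterate_shiftMap_apply]
      exact hxy _ (by omega) (by omega)
    simpa [iterate_shiftMap_apply] using this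
  · rw [shannon_comp hΦ (measurable_window 0 n)]

lemma exists_shannon_window_le (h1 : ∀ a, Function.Injective (φ a))
    (h2 : ∀ b, Function.Injective fun a => φ a b)
    (hσ : MeasurePreserving shiftMap μ μ) (hΦ : MeasurePreserving (CA φ) μ μ)
    (hZ : ∀ c : ℝ≥0∞, 0 < c → ∃ Z, IsCompact Z ∧ Set.InjOn (CA φ) Z ∧ 1 < μ Z + c)
    {δ : ℝ} (hδ : 0 < δ) :
    ∃ C : ℝ, ∀ n : ℕ, shannon μ (window 0 n) ≤ C + n * δ := by
  obtain ⟨n₀, hn₀⟩ := exists_shannon_window_succ_le h1 h2 hσ hΦ hZ hδ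
  have mono : ∀ n m : ℕ, n ≤ m → shannon μ (window 0 n) ≤ shannon μ (window 0 m) :=
    fun n m hnm => shannon_le_of_factor (measurable_window 0 m) fun x y hxy => by
      rw [window_eq_iff] at hxy ⊢
      exact fun i hi hin => hxy i hi (by omega)
  have step : ∀ n : ℕ, shannon μ (window 0 (n₀ + n)) ≤ shannon μ (window 0 n₀) + n * δ := by
    intro n
    induction n with
    | zero => simp
    | succ n ih =>
      have := hn₀ (n₀ + n) (by omega)
      push_cast
      rw [← add_assoc]
      linarith
  exact ⟨_, fun n => (mono n (n₀ + n) (by omega)).trans (step n)⟩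

lemma joinEntropy_eq_shannon {X : Type*} [MeasurableSpace X] {μ : Measure X} {T : X → X} {r : ℕ}
    {P : Fin r → Set X} {f : X → Fin r} (hf : ∀ x i, x ∈ P i ↔ f x = i) (n : ℕ) :
    joinEntropy μ T P n = shannon μ (fun x (i : Fin n) => f (T^[i] x)) := by
  rw [joinEntropy, shannon, ← Finset.sum_neg_distrib]
  refine Finset.sum_congr rfl fun c _ => ?_
  have : (⋂ i : Fin n, T^[(i : ℕ)] ⁻¹' P (c i)) =
      (fun x (i : Fin n) => f (T^[i] x)) ⁻¹' {c} := by
    ext x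
    simp [hf, funext_iff]
  rw [this, Real.negMulLog, neg_mul]
  rfl

lemma exists_shannon_iterate_le (h1 : ∀ a, Function.Injective (φ a))
    (h2 : ∀ b, Function.Injective fun a => φ a b)
    (hσ : MeasurePreserving shiftMap μ μ) (hΦ : MeasurePreserving (CA φ) μ μ)
    (hZ : ∀ c : ℝ≥0∞, 0 < c → ∃ Z, IsCompact Z ∧ Set.InjOn (CA φ) Z ∧ 1 < μ Z + c)
    {r : ℕ} {f : (ℤ → A) → Fin r} (hf : Measurable f) {δ : ℝ} (hδ : 0 < δ) :
    ∃ C : ℝ, ∀ n : ℕ, shannon μ (fun x (i : Fin n) => f ((CA φ)^[i] x)) ≤ C + n * δ := by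
  obtain ⟨C, hC⟩ := exists_shannon_window_le h1 h2 hσ hΦ hZ (half_pos hδ)
  obtain ⟨ε, hε, hF⟩ := exists_shannon_prod_le (μ := μ) (Fin r) (half_pos hδ)
  obtain ⟨S, k, hS, hμS, hSf⟩ := exists_approx (μ := μ) hf hε
  refine ⟨C + (2 * k + 1) * (δ / 2), fun n => ?_⟩
  let L : ℕ := n + (2 * k + 1)
  have hmw : Measurable (window (-k) L : (ℤ → A) → _) := measurable_window _ _
  have hmi : ∀ i : ℕ, Measurable fun x => f ((CA φ)^[i] x) := fun i =>
    hf.comp (hΦ.iterate i).measurable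
  have hmf : ∀ m : ℕ, Measurable fun x (i : Fin m) => f ((CA φ)^[i] x) := fun m =>
    measurable_pi_lambda _ fun i => hmi i
  have CAit : ∀ (i : ℕ) (x y : ℤ → A) (s t : ℤ), (∀ m, s ≤ m → m ≤ t + i → x m = y m) →
      ∀ m, s ≤ m → m ≤ t → (CA φ)^[i] x m = (CA φ)^[i] y m := by
    intro i
    induction i with
    | zero => exact fun x y s t h m h1 h2 => h m h1 (by simpa using h2)
    | succ i ih =>
      intro x y s t h m h1 h2
      rw [Function.iterate_succ_apply, Function.iterate_succ_apply]
      refine ih _ _ s t (fun m h3 h4 => ?_) m h1 h2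
      simp only [CA]
      rw [h m h3 (by push_cast; omega), h (m + 1) (by omega) (by push_cast; omega)]
  have step : ∀ m : ℕ, m ≤ n →
      shannon μ (fun x => ((fun i : Fin m => f ((CA φ)^[i] x)), window (-k) L x)) ≤
        shannon μ (window (-k : ℤ) L) + m * (δ / 2) := by
    intro m
    induction m with
    | zero =>
      intro _
      rw [Nat.cast_zero, zero_mul, add_zero]
      exact shannon_le_of_factor hmw fun x y hxy => Prod.ext (Subsingleton.elim _ _) hxy
    | succ m ih =>
      intro hm
      have hg := (hmf m).prodMk hmw
      refine (shannon_le_of_factor ((hmi m).prodMk hg) fun x y hxy => ?_).trans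
        ((hF (hmi m) hg (S := (CA φ)^[m] ⁻¹' S) ?_ ?_).trans ?_)
      · simp only [Prod.mk.injEq] at hxy ⊢
        refine ⟨funext fun i => ?_, hxy.2.2⟩
        refine Fin.lastCases ?_ (fun i => ?_) i
        · simpa using hxy.1
        · simpa using congrFun hxy.2.1 i
      · rw [← Set.preimage_compl,
          (hΦ.iterate m).measureReal_preimage hS.compl.nullMeasurableSet]
        exact hμS
      · intro x hx y hy hxy
        have hw := window_eq_iff.1 (Prod.mk.inj hxy).2
        exact hSf _ hx _ hy (CAit m x y _ _ fun i h3 h4 => hw i h3 (by simp only [L]; push_cast; omega))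
      · have := ih (by omega)
        push_cast
        linarith
  have h3 := hC L
  rw [← shannon_window hσ k] at h3
  have h4 : shannon μ (fun x (i : Fin n) => f ((CA φ)^[i] x)) ≤
      shannon μ (fun x => ((fun i : Fin n => f ((CA φ)^[i] x)), window (-k) L x)) :=
    shannon_le_of_factor ((hmf n).prodMk hmw) fun x y hxy => (Prod.mk.inj hxy).1
  have h5 := step n le_rfl
  simp only [L] at h3 h4 h5
  push_cast at h3
  linarith

/-- If `CA φ` has positive entropy then it is not injective on compact sets of measure close
to `1`. -/
lemma KSEntropyPos.exists_le_of_injOn (hpos : KSEntropyPos μ (CA φ))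
    (h1 : ∀ a, Function.Injective (φ a)) (h2 : ∀ b, Function.Injective fun a => φ a b)
    (hσ : MeasurePreserving shiftMap μ μ) (hΦ : MeasurePreserving (CA φ) μ μ) :
    ∃ c : ℝ≥0∞, 0 < c ∧ ∀ Z, IsCompact Z → Set.InjOn (CA φ) Z → μ Z + c ≤ 1 := by
  by_contra! hZ
  obtain ⟨r, P, hP, hdisj, hcov, hlim⟩ := hpos
  have hex : ∀ x, ∃ i, x ∈ P i := fun x => by
    have : x ∈ ⋃ i, P i := hcov ▸ Set.mem_univ x
    simpa using this
  choose f hfP using hex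
  have hf : ∀ x i, x ∈ P i ↔ f x = i := fun x i =>
    ⟨fun h => by
      by_contra hne
      exact Set.disjoint_left.1 (hdisj hne) (hfP x) h, fun h => h ▸ hfP x⟩
  have hfm : Measurable f := measurable_to_countable' fun i => by
    have : f ⁻¹' {i} = P i := by ext x; simp [hf]
    rw [this]
    exact hP i
  rw [Filter.liminf_eq] at hlim
  obtain ⟨t, ht, ht0⟩ : ∃ t ∈ {t : ℝ | ∀ᶠ n : ℕ in atTop, t ≤ joinEntropy μ (CA φ) P n / n},
      0 < t := by
    by_contra! h
    exact absurd hlim (not_lt.2 (Real.sSup_nonpos h))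
  obtain ⟨C, hC⟩ := exists_shannon_iterate_le h1 h2 hσ hΦ
    (fun c hc => by simpa using hZ c hc) hfm (half_pos ht0)
  have hlarge : ∀ᶠ n : ℕ in atTop, C / (t / 2) < n :=
    (tendsto_natCast_atTop_atTop.eventually_gt_atTop _)
  obtain ⟨n, hn, hn', hn0⟩ := ((show
    ∀ᶠ n : ℕ in atTop, t ≤ joinEntropy μ (CA φ) P n / n from ht).and (hlarge.and (eventually_gt_atTop 0))).exists
  have hn0' : (0 : ℝ) < n := by exact_mod_cast hn0
  rw [joinEntropy_eq_shannon hf, le_div_iff₀ hn0'] at hn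
  rw [div_lt_iff₀ (half_pos ht0)] at hn'
  have := hC n
  nlinarith

end Entropy

section Ergodic

variable {X : Type*} [MeasurableSpace X] {μ : Measure X} {S T : X → X}

lemma exists_invariant_of_ae_invariant (hST : Function.Commute S T) (hS : MeasurePreserving S μ μ)
    (hT : MeasurePreserving T μ μ) {s : Set X} (hs : MeasurableSet s) (hSs : S ⁻¹' s =ᵐ[μ] s)
    (hTs : T ⁻¹' s =ᵐ[μ] s) :
    ∃ t, MeasurableSet t ∧ t =ᵐ[μ] s ∧ S ⁻¹' t = t ∧ T ⁻¹' t = t := by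
  obtain ⟨s', hs', hss', hSs'⟩ :=
    hS.quasiMeasurePreserving.exists_preimage_eq_of_preimage_ae hs.nullMeasurableSet hSs
  have hTs' : T ⁻¹' s' =ᵐ[μ] s' :=
    (hT.quasiMeasurePreserving.preimage_ae_eq hss').trans (hTs.trans hss'.symm)
  have hmem : ∀ x, S x ∈ s' ↔ x ∈ s' := fun x => Set.ext_iff.1 hSs' x
  refine ⟨{x | ∃ᶠ n in atTop, T^[n] x ∈ s'}, ?_, ?_, ?_, ?_⟩
  · simp only [frequently_atTop, Set.ofPred_forall, Set.ofPred_exists]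
    exact MeasurableSet.iInter fun N => MeasurableSet.iUnion fun n =>
      (MeasurableSet.const _).inter ((hT.iterate n).measurable hs')
  · refine EventuallyEq.trans ?_ hss'
    have h : ∀ᵐ x ∂μ, ∀ n, T^[n] x ∈ s' ↔ x ∈ s' := ae_all_iff.2 fun n =>
      eventuallyEq_set.1 (hT.quasiMeasurePreserving.preimage_iterate_ae_eq n hTs')
    refine eventuallyEq_set.2 (h.mono fun x hx => ?_)
    simp [hx]
  · ext x
    simp only [Set.mem_preimage, Set.mem_ofPred_eq, ← (hST.iterate_right _).eq, hmem]
  · ext x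
    simp only [Set.mem_preimage, Set.mem_ofPred_eq, ← Function.iterate_succ_apply]
    conv_rhs => rw [← map_add_atTop_eq_nat 1, frequently_map]

lemma ae_eq_const_of_ae_invariant [IsProbabilityMeasure μ] (hST : Function.Commute S T)
    (hS : MeasurePreserving S μ μ) (hT : MeasurePreserving T μ μ)
    (herg : ∀ s : Set X, MeasurableSet s → S ⁻¹' s = s → T ⁻¹' s = s → μ s = 0 ∨ μ s = 1)
    {f : X → ℝ≥0∞} (hf : Measurable f) (hfS : f ∘ S =ᵐ[μ] f) (hfT : f ∘ T =ᵐ[μ] f) :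
    ∃ k, f =ᵐ[μ] Function.const X k := by
  refine exists_eventuallyEq_const_of_forall_separating MeasurableSet fun U hU => ?_
  obtain ⟨t, ht, hts, hSt, hTt⟩ := exists_invariant_of_ae_invariant hST hS hT (hf hU)
    (hfS.preimage U) (hfT.preimage U)
  have hiff := eventuallyEq_set.1 hts
  rcases herg t ht hSt hTt with h | h
  · refine Or.inr ?_
    filter_upwards [hiff, measure_eq_zero_iff_ae_notMem.1 h] with x hx hx' hxU
    exact hx' (hx.2 hxU)
  · refine Or.inl ?_
    have h' : ∀ᵐ x ∂μ, x ∈ t := by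
      rw [← prob_compl_eq_zero_iff ht] at h
      exact h
    filter_upwards [hiff, h'] with x hx hx'
    exact hx.1 hx'

/-- An invariant probability measure absolutely continuous with respect to an ergodic one equals
it. -/
lemma eq_of_absolutelyContinuous [IsProbabilityMeasure μ] (hST : Function.Commute S T)
    (hS : MeasurePreserving S μ μ) (hT : MeasurePreserving T μ μ)
    (herg : ∀ s : Set X, MeasurableSet s → S ⁻¹' s = s → T ⁻¹' s = s → μ s = 0 ∨ μ s = 1)
    {ν : Measure X} [IsProbabilityMeasure ν] (hSν : MeasurePreserving S ν ν)
    (hTν : MeasurePreserving T ν ν) (hν : ν ≪ μ) : ν = μ := by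
  obtain ⟨k, hk⟩ := ae_eq_const_of_ae_invariant hST hS hT herg (Measure.measurable_rnDeriv ν μ)
    (hSν.rnDeriv_comp_aeEq hS) (hTν.rnDeriv_comp_aeEq hT)
  have h1 : ν = k • μ := by
    rw [← Measure.withDensity_rnDeriv_eq ν μ hν, withDensity_congr_ae hk]
    exact withDensity_const k
  have h2 : k = 1 := by
    have := congrArg (fun m : Measure X => m Set.univ) h1
    simpa using this.symm
  rw [h1, h2, one_smul]

end Ergodic

section Haar

variable {p : ℕ} [Fact p.Prime] {a b : ZMod p}

lemma exists_invariant_measure (ha : a ≠ 0) (hb : b ≠ 0) :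
    ∃ m : Measure (ℤ → ZMod p), IsProbabilityMeasure m ∧ MeasurePreserving shiftMap m m ∧
      MeasurePreserving (linCA a b) m m ∧ ∀ v, MeasurePreserving (fun x => x + v) m m := by
  let m : Measure (ℤ → ZMod p) := Measure.addHaarMeasure ⊤
  have hm : IsProbabilityMeasure m := ⟨Measure.addHaarMeasure_self⟩
  refine ⟨m, hm, ?_, ?_, fun v => measurePreserving_add_right m v⟩
  · refine AddMonoidHom.measurePreserving (f := (shiftLin p).toAddMonoidHom)
      (continuous_pi fun i => continuous_apply (i + 1)) (fun v => ?_) rfl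
    exact ⟨fun i => v (i - 1), funext fun i => by simp [shiftLin_apply, shiftMap]⟩
  · refine AddMonoidHom.measurePreserving (f := (linCA a b).toAddMonoidHom)
      (continuous_pi fun i => ?_) (linCA_surjective ha hb) rfl
    simp only [LinearMap.toAddMonoidHom_coe, linCA_apply]
    fun_prop

end Haar

/-- Absolute continuity can be tested on sets determined by finitely many coordinates. -/
lemma absolutelyContinuous_of_window {A : Type*} [Finite A] [TopologicalSpace A]
    [DiscreteTopology A] [MeasurableSpace A] [MeasurableSingletonClass A]
    {μ ν : Measure (ℤ → A)} [IsFiniteMeasure μ] [IsFiniteMeasure ν] {c : ℝ≥0∞} (hc : 0 < c)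
    (h : ∀ (k : ℕ) (C : Set (ℤ → A)), MeasurableSet C →
      (∀ x y, (∀ i : ℤ, -k ≤ i → i ≤ k → x i = y i) → x ∈ C → y ∈ C) → c * ν C ≤ μ C) :
    ν ≪ μ := by
  refine Measure.AbsolutelyContinuous.mk fun s hs hμs => ?_
  rw [hs.measure_eq_iSup_isCompact_of_ne_top (measure_ne_top ν s)]
  simp only [ENNReal.iSup_eq_zero]
  intro K hKs hK
  by_contra hne
  have hlt : μ K < c * ν K := by
    rw [measure_mono_null hKs hμs]
    exact ENNReal.mul_pos hc.ne' hne
  obtain ⟨U, hKU, hU, hμU⟩ := K.exists_isOpen_lt_of_lt _ hlt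
  obtain ⟨k, hk⟩ := exists_separating_window (continuous_id (X := ℤ → A))
    (K := fun b : Bool => cond b K Uᶜ) (fun b => by
      cases b
      · exact hU.isClosed_compl.isCompact
      · exact hK)
    (fun b b' x hx y hy (hxy : x = y) => by
      subst hxy
      cases b <;> cases b' <;> simp_all
      · exact hx (hKU hy)
      · exact hy (hKU hx))
  let C : Set (ℤ → A) := window (-k) (2 * k + 1) ⁻¹' (window (-k) (2 * k + 1) '' K)
  have hCm : MeasurableSet C := measurable_window _ _ (Set.toFinite _).measurableSet
  have h1 := h k C hCm fun x y hxy ⟨z, hz, hzx⟩ => ⟨z, hz, hzx.trans (window_eq_iff.2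
    fun i h1 h2 => hxy i h1 (by push_cast at h2; omega))⟩
  have hKC : K ⊆ C := Set.subset_preimage_image _ _
  have hCU : C ⊆ U := fun x ⟨z, hz, hzx⟩ => by
    by_contra hx
    have := hk true false z hz x hx fun i h1 h2 =>
      window_eq_iff.1 hzx i h1 (by push_cast; omega)
    simp at this
  exact absurd (((mul_le_mul_right (measure_mono hKC) c).trans h1).trans (measure_mono hCU))
    (not_le.2 hμU)

section Rigidity

variable {G : Type*} [AddCommGroup G] [Finite G] [MeasurableSpace G] [MeasurableSingletonClass G]
  {p : ℕ} [Fact p.Prime] {E : Set (G × G)} {φ : G → G → G} {a b : ZMod p}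
  {ι : (ℤ → ZMod p) →+ (ℤ → G)} {ℓ : ℕ} (hc : IsCoord E φ a b ι ℓ)
include hc

lemma IsCoord.measurable_translate :
    Measurable fun z : (ℤ → G) × (ℤ → ZMod p) => z.1 + ι z.2 := by
  refine measurable_pi_lambda _ fun i => ?_
  have h : (fun v => ι v i) =
      Function.extend (window (i - ℓ) ℓ) (fun v => ι v i) 0 ∘ window (i - ℓ) ℓ := by
    funext v
    refine (Function.FactorsThrough.extend_apply (f := window (i - ℓ) ℓ)
      (g := fun v => ι v i) (fun v w hvw => ?_) 0 v).symm
    exact hc.congr fun j h1 h2 => window_eq_iff.1 hvw j h1 (by omega)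
  have hm : Measurable fun v => ι v i := by
    rw [h]
    exact Measurable.of_discrete.comp (measurable_window _ _)
  have hadd : Measurable fun y : G × G => y.1 + y.2 := Measurable.of_discrete
  have hfst : Measurable fun z : (ℤ → G) × (ℤ → ZMod p) => z.1 i :=
    (measurable_pi_apply i).comp measurable_fst
  exact hadd.comp (hfst.prodMk (hm.comp measurable_snd))

lemma IsCoord.setLIntegral_measure_translate {μ : Measure (ℤ → G)} [IsFiniteMeasure μ]
    (m : Measure (ℤ → ZMod p)) [IsProbabilityMeasure m] {j W : ℕ} (hj : W + ℓ ≤ j)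
    {B C : Set (ℤ → G)}
    (hB : ∀ d, (linCA a b ^ j) d = 0 → μ (B ∩ (fun x => x + ι d) ⁻¹' C) = μ (B ∩ C))
    (hCm : MeasurableSet C)
    (hC : ∀ x y : ℤ → G, (∀ i : ℤ, 0 ≤ i → i < W → x i = y i) → x ∈ C → y ∈ C) :
    ∫⁻ x in B, m {v | x + ι v ∈ C} ∂μ = μ (B ∩ C) := by
  have hD := hc.measurable_translate hCm
  have h1 := Measure.prod_apply (μ := μ.restrict B) (ν := m) hD
  rw [Measure.prod_apply_symm hD] at h1
  refine Eq.trans h1.symm ?_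
  have h2 : ∀ v : ℤ → ZMod p, (μ.restrict B) ((fun x => x + ι v) ⁻¹' C) = μ (B ∩ C) := by
    intro v
    obtain ⟨d, hd, hdv⟩ := exists_ker_eq_window hc.a_ne hc.b_ne j v (-ℓ)
    have h3 : ∀ i : ℤ, 0 ≤ i → i < W → ι v i = ι d i := fun i h0 hi =>
      hc.congr fun t ht ht' => (hdv t (by omega) (by omega)).symm
    have h4 : (fun x => x + ι v) ⁻¹' C = (fun x => x + ι d) ⁻¹' C := by
      ext x
      exact ⟨hC _ _ fun i h0 hi => by simp [h3 i h0 hi], hC _ _ fun i h0 hi => by simp [h3 i h0 hi]⟩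
    rw [Measure.restrict_apply (measurable_add_const_pi _ hCm), Set.inter_comm, h4, hB d hd]
  calc _ = ∫⁻ _, μ (B ∩ C) ∂m := lintegral_congr h2
    _ = μ (B ∩ C) := by simp

omit [Finite G] [MeasurableSpace G] [MeasurableSingletonClass G] in
lemma IsCoord.measure_translate_eq {m : Measure (ℤ → ZMod p)}
    (hm : ∀ v, MeasurePreserving (fun x => x + v) m m) {W : ℕ} {C : Set (ℤ → G)}
    (hC : ∀ x y : ℤ → G, (∀ i : ℤ, 0 ≤ i → i < W → x i = y i) → x ∈ C → y ∈ C)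
    {x y : ℤ → G} (hx : x ∈ TMC E) (hy : y ∈ TMC E) (h : Linked ι x y) :
    m {v | y + ι v ∈ C} = m {v | x + ι v ∈ C} := by
  obtain ⟨v, hv⟩ := hc.linked_cover hx hy h W
  refine Eq.trans ?_ ((hm v).measure_preimage_equiv (f := MeasurableEquiv.addRight v) _)
  congr 1
  ext u
  have h1 : ∀ i : ℤ, 0 ≤ i → i < W → (y + ι u) i = (x + ι (u + v)) i := fun i h0 hi => by
    simp only [Pi.add_apply, map_add, hv i h0 hi.le]
    abel
  exact ⟨hC _ _ h1, hC _ _ fun i h0 hi => (h1 i h0 hi).symm⟩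

variable {μ : Measure (ℤ → G)} [IsProbabilityMeasure μ]

/-- The measure obtained by averaging `μ` over the translations by `ι v` charges windows at most
proportionally to `μ`. -/
lemma IsCoord.mul_measure_le (hirr : IrreducibleTMC E) (hμE : ∀ᵐ x ∂μ, x ∈ TMC E)
    (hσ : MeasurePreserving shiftMap μ μ) {m : Measure (ℤ → ZMod p)} [IsProbabilityMeasure m]
    (hmσ : MeasurePreserving shiftMap m m) (hm : ∀ v, MeasurePreserving (fun x => x + v) m m)
    {c : ℝ≥0∞} (hB : ∀ j, ∃ B, MeasurableSet B ∧ c ≤ μ B ∧ ∀ d, (linCA a b ^ j) d = 0 →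
      ∀ S, MeasurableSet S → μ (B ∩ (fun x => x + ι d) ⁻¹' S) = μ (B ∩ S))
    {W : ℕ} {C : Set (ℤ → G)} (hCm : MeasurableSet C)
    (hC : ∀ x y : ℤ → G, (∀ i : ℤ, 0 ≤ i → i < W → x i = y i) → x ∈ C → y ∈ C) :
    c * ∫⁻ x, m {v | x + ι v ∈ C} ∂μ ≤ μ C := by
  obtain ⟨q, hq, hper⟩ := hc.exists_period hirr
  obtain ⟨B, hBm, hcB, hBd⟩ := hB (W + q + ℓ)
  set F : (ℤ → G) → ℝ≥0∞ := fun x => m {v | x + ι v ∈ C}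
  have hFm : Measurable F := measurable_measure_prodMk_left (hc.measurable_translate hCm)
  set S : (ℤ → G) → ℝ≥0∞ := fun x => ∑ i ∈ Finset.range q, F (shiftMap^[i] x)
  have hlink : ∀ x ∈ TMC E, ∀ y ∈ TMC E, Linked ι x y → S x = S y := fun x hx y hy h =>
    Finset.sum_congr rfl fun i _ => (hc.measure_translate_eq hm hC (mem_TMC_iterate hx i)
      (mem_TMC_iterate hy i) (hc.linked_shift hx hy h i)).symm
  have hshift : ∀ x ∈ TMC E, S (shiftMap x) = S x := by
    intro x hx
    have h1 : F (shiftMap^[q] x) = F x :=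
      (hc.measure_translate_eq hm hC (mem_TMC_iterate hx q) hx (hper x hx)).symm
    have h2 := Finset.sum_range_succ (fun i => F (shiftMap^[i] x)) q
    rw [Finset.sum_range_succ', h1] at h2
    exact (ENNReal.add_left_inj (measure_ne_top _ _)).1 h2
  have hiter : ∀ x ∈ TMC E, ∀ k : ℕ, S (shiftMap^[k] x) = S x := by
    intro x hx k
    induction k with
    | zero => rfl
    | succ k ih => rw [Function.iterate_succ_apply', hshift _ (mem_TMC_iterate hx k), ih]
  obtain ⟨x₀, hx₀⟩ := hμE.exists
  have hconst : ∀ x ∈ TMC E, S x = S x₀ := by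
    intro x hx
    obtain ⟨k, -, hk⟩ := hc.exists_linked hirr hx₀ x
    rw [← hiter x₀ hx₀ k]
    exact (hlink _ (mem_TMC_iterate hx₀ k) x hx hk).symm
  have hcomp : ∀ i x, F (shiftMap^[i] x) = m {v | x + ι v ∈ shiftMap^[i] ⁻¹' C} := by
    intro i x
    have hpre : MeasurableSet {v | shiftMap^[i] x + ι v ∈ C} :=
      measurable_prodMk_left (hc.measurable_translate hCm)
    refine ((hmσ.iterate i).measure_preimage hpre.nullMeasurableSet).symm.trans ?_
    congr 1
    ext v
    have h1 : shiftMap^[i] x + ι (shiftMap^[i] v) = shiftMap^[i] (x + ι v) := by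
      rw [hc.iterate_shift]
      ext n
      simp only [Pi.add_apply, iterate_shiftMap_apply]
    change shiftMap^[i] x + ι (shiftMap^[i] v) ∈ C ↔ shiftMap^[i] (x + ι v) ∈ C
    rw [h1]
  have hsum : ∀ ν : Measure (ℤ → G),
      ∫⁻ x, S x ∂ν = ∑ i ∈ Finset.range q, ∫⁻ x, F (shiftMap^[i] x) ∂ν := fun ν =>
    lintegral_finsetSum _ fun i _ => hFm.comp (hσ.iterate i).measurable
  have hleft : q * ∫⁻ x, F x ∂μ = S x₀ := by
    have h1 : ∫⁻ x, S x ∂μ = q * ∫⁻ x, F x ∂μ := by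
      rw [hsum, Finset.sum_congr rfl fun i _ => (hσ.iterate i).lintegral_comp hFm]
      simp
    rw [← h1, lintegral_congr_ae (hμE.mono hconst)]
    simp
  have hright : c * S x₀ ≤ q * μ C := by
    have h1 : ∫⁻ x in B, S x ∂μ = S x₀ * μ B := by
      rw [lintegral_congr_ae ((ae_restrict_of_ae hμE).mono hconst)]
      simp
    have h2 : ∫⁻ x in B, S x ∂μ ≤ q * μ C := by
      rw [hsum]
      calc _ ≤ ∑ i ∈ Finset.range q, μ C := by
            refine Finset.sum_le_sum fun i hi => ?_
            have hi := Finset.mem_range.1 hi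
            have hCi : MeasurableSet (shiftMap^[i] ⁻¹' C) := (hσ.iterate i).measurable hCm
            rw [lintegral_congr (hcomp i), hc.setLIntegral_measure_translate m (W := W + q) le_rfl
              (fun d hd => hBd d hd _ hCi) hCi,
              ← (hσ.iterate i).measure_preimage hCm.nullMeasurableSet]
            · exact measure_mono Set.inter_subset_right
            · intro x y hxy
              refine hC _ _ fun n h0 hn => ?_
              simp only [iterate_shiftMap_apply]
              exact hxy _ (by omega) (by push_cast; omega)
        _ = q * μ C := by simp
    calc c * S x₀ ≤ μ B * S x₀ := by gcongr
      _ = S x₀ * μ B := mul_comm _ _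
      _ ≤ q * μ C := h1 ▸ h2
  rw [← hleft, mul_left_comm] at hright
  exact (ENNReal.mul_le_mul_iff_right (by simpa using (by omega : q ≠ 0))
    (ENNReal.natCast_ne_top q)).1 hright

end Rigidity

section Invariance

variable {G : Type*} [AddCommGroup G] [Finite G] [TopologicalSpace G] [DiscreteTopology G]
  [MeasurableSpace G] [MeasurableSingletonClass G]
  {p : ℕ} [Fact p.Prime] {E : Set (G × G)} {φ : G → G → G} {a b : ZMod p}
  {ι : (ℤ → ZMod p) →+ (ℤ → G)} {ℓ : ℕ} (hc : IsCoord E φ a b ι ℓ)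
  {μ : Measure (ℤ → G)} [IsProbabilityMeasure μ]
include hc

lemma IsCoord.measurePreserving_translate (hirr : IrreducibleTMC E)
    (hμE : ∀ᵐ x ∂μ, x ∈ TMC E) (hσ : MeasurePreserving shiftMap μ μ)
    (hΦ : MeasurePreserving (CA φ) μ μ)
    (herg : ∀ s : Set (ℤ → G), MeasurableSet s →
      shiftMap ⁻¹' s = s → CA φ ⁻¹' s = s → μ s = 0 ∨ μ s = 1)
    {c : ℝ≥0∞} (h0 : 0 < c) (hB : ∀ j, ∃ B, MeasurableSet B ∧ c ≤ μ B ∧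
      ∀ d, (linCA a b ^ j) d = 0 →
        ∀ S, MeasurableSet S → μ (B ∩ (fun x => x + ι d) ⁻¹' S) = μ (B ∩ S))
    (v : ℤ → ZMod p) : MeasurePreserving (fun x => x + ι v) μ μ := by
  obtain ⟨m, hm, hmσ, hmL, hmv⟩ := exists_invariant_measure (p := p) hc.a_ne hc.b_ne
  have hA := hc.measurable_translate
  set ν : Measure (ℤ → G) :=
    (μ.prod m).map fun z : (ℤ → G) × (ℤ → ZMod p) => z.1 + ι z.2 with hν
  have hνp : IsProbabilityMeasure ν := Measure.isProbabilityMeasure_map hA.aemeasurable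
  have hlift : ∀ (f : (ℤ → G) → ℤ → G) (g : (ℤ → G) → ℤ → G)
      (h : (ℤ → ZMod p) → ℤ → ZMod p), Measurable f → MeasurePreserving g μ μ →
      MeasurePreserving h m m → (∀ x w, f (x + ι w) = g x + ι (h w)) →
      MeasurePreserving f ν ν := by
    intro f g h hf hg hh hfgh
    refine ⟨hf, ?_⟩
    have h1 := (hg.prod hh).map_eq
    rw [hν, Measure.map_map hf hA]
    conv_rhs => rw [← h1, Measure.map_map hA (hg.prod hh).measurable]
    congr 1
    ext1 z
    exact hfgh _ _
  have hνσ : MeasurePreserving shiftMap ν ν := by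
    refine hlift _ _ _ measurable_shiftMap hσ hmσ fun x w => ?_
    rw [hc.shift]
    rfl
  have hνΦ : MeasurePreserving (CA φ) ν ν :=
    hlift _ _ _ hΦ.measurable hΦ hmL hc.CA_add
  have hνv : MeasurePreserving (fun x => x + ι v) ν ν :=
    hlift _ _ _ (measurable_add_const_pi _) (MeasurePreserving.id μ) (hmv v) fun x w => by
      simp [add_assoc]
  have hac : ν ≪ μ := by
    refine absolutelyContinuous_of_window h0 fun k C hC hCk => ?_
    have h1 : MeasurableSet (shiftMap^[k] ⁻¹' C) := (hσ.iterate k).measurable hC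
    have h2 := hc.mul_measure_le hirr hμE hσ hmσ hmv hB (W := 2 * k + 1) h1 fun x y hxy => by
      refine hCk _ _ fun i hi hi' => ?_
      simp only [iterate_shiftMap_apply]
      exact hxy _ (by omega) (by push_cast; omega)
    rw [← (hσ.iterate k).measure_preimage hC.nullMeasurableSet,
      ← (hνσ.iterate k).measure_preimage hC.nullMeasurableSet, hν,
      Measure.map_apply hA h1, Measure.prod_apply (hA h1)]
    exact h2
  have hνμ : ν = μ := eq_of_absolutelyContinuous
    (show Function.Commute shiftMap (CA φ) from fun x => (CA_shiftMap φ x).symm)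
    hσ hΦ herg hνσ hνΦ hac
  rwa [hνμ] at hνv

end Invariance

section Parry

lemma measurableSet_cyl {A : Type*} [MeasurableSpace A] [MeasurableSingletonClass A] {m : ℕ}
    (w : Fin m → A) : MeasurableSet (cyl w) := by
  rw [cyl, Set.ofPred_forall]
  exact MeasurableSet.iInter fun i =>
    (measurable_pi_apply (X := fun _ : ℤ => A) ((i : ℕ) : ℤ)) (measurableSet_singleton (w i))

lemma measure_eq_mul_of_fibers {X A : Type*} [MeasurableSpace X] [Fintype A] [MeasurableSpace A]
    [MeasurableSingletonClass A] {μ : Measure X} {f : X → A} (hf : Measurable f) {S : Set X}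
    (N : Set A) {t : ℝ≥0∞} (h0 : ∀ g ∉ N, μ (f ⁻¹' {g} ∩ S) = 0)
    (h1 : ∀ g ∈ N, μ (f ⁻¹' {g} ∩ S) = t) : μ S = N.ncard * t := by
  classical
  have h2 : μ S = ∑ g, μ (f ⁻¹' {g} ∩ S) := by
    have := sum_measure_preimage_singleton (μ := μ.restrict S) (f := f) Finset.univ
      fun g _ => hf (measurableSet_singleton g)
    simp only [Measure.restrict_apply (hf (measurableSet_singleton _))] at this
    simpa using this.symm
  rw [h2, Set.ncard_eq_toFinset_card', ← nsmul_eq_mul, ← Finset.sum_const]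
  refine (Finset.sum_subset (Finset.subset_univ _) fun g _ hg => h0 g (by simpa using hg)).symm.trans
    (Finset.sum_congr rfl fun g hg => h1 g (by simpa using hg))

variable {G : Type*} [AddCommGroup G] [Fintype G] [MeasurableSpace G] [MeasurableSingletonClass G]
  {p : ℕ} [Fact p.Prime] {E : Set (G × G)} {φ : G → G → G} {a b : ZMod p}
  {ι : (ℤ → ZMod p) →+ (ℤ → G)} {ℓ : ℕ} (hc : IsCoord E φ a b ι ℓ)
  {μ : Measure (ℤ → G)}
include hc

omit [Fintype G] in
lemma IsCoord.measure_cyl_eq_of_linked (hμ : ∀ v, MeasurePreserving (fun x => x + ι v) μ μ)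
    {x y : ℤ → G} (hx : x ∈ TMC E) (hy : y ∈ TMC E) (h : Linked ι x y) (m : ℕ) :
    μ (cyl fun i : Fin m => x (i : ℕ)) = μ (cyl fun i : Fin m => y (i : ℕ)) := by
  obtain ⟨v, hv⟩ := hc.linked_cover hx hy h m
  rw [← (hμ v).measure_preimage (measurableSet_cyl (fun i : Fin m => y (i : ℕ))).nullMeasurableSet]
  congr 1
  ext z
  refine forall_congr' fun i => ?_
  change z _ = x _ ↔ z _ + ι v _ = y _
  rw [hv _ (by omega) (by omega), add_left_inj]

lemma IsCoord.measure_cyl_shiftMap (hE : EveryLetterOccurs E) (hirr : IrreducibleTMC E)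
    (hμ : ∀ v, MeasurePreserving (fun x => x + ι v) μ μ) (hσ : MeasurePreserving shiftMap μ μ)
    (hμE : ∀ᵐ x ∂μ, x ∈ TMC E) {x : ℤ → G} (hx : x ∈ TMC E) (m : ℕ) :
    μ (cyl fun i : Fin (m + 1) => shiftMap x (i : ℕ)) =
      μ (cyl fun i : Fin (m + 1) => x (i : ℕ)) := by
  have hnull : ∀ S : Set (ℤ → G), (∀ z ∈ S, z ∉ TMC E) → μ S = 0 := fun S hS =>
    measure_mono_null hS (ae_iff.1 hμE)
  set t := μ (cyl fun i : Fin (m + 1 + 1) => x (i : ℕ)) with ht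
  have hright : μ (cyl fun i : Fin (m + 1) => x (i : ℕ)) = p * t := by
    rw [← hc.outdegree (x m)]
    refine measure_eq_mul_of_fibers (measurable_pi_apply ((m : ℤ) + 1)) _ (fun g hg => ?_)
      fun g hg => ?_
    · refine hnull _ fun z hz hzE => hg ?_
      have h1 : z m = x m := hz.2 (Fin.last m)
      have h2 : z (m + 1) = g := hz.1
      have h3 := hzE m
      rwa [h1, h2] at h3
    · obtain ⟨u, hu, s, rfl⟩ := hE g
      set y : ℤ → G := fun n => if n ≤ m then x n else u (n + (s - (m + 1))) with hy
      have hyE : y ∈ TMC E := mem_TMC_glue hx (mem_TMC_shift hu (s - (m + 1))) (by simpa using hg)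
      rw [ht, hc.measure_cyl_eq_of_linked hμ hx hyE (Linked.of_eq (by simp [hy]))]
      congr 1
      ext z
      refine Iff.trans ?_ (Fin.forall_fin_succ' (P := fun i => z ((i : ℕ) : ℤ) = y (i : ℕ))).symm
      rw [Set.mem_inter_iff, and_comm]
      refine and_congr (forall_congr' fun i => ?_) ?_
      · have h1 : ((i : ℕ) : ℤ) ≤ m := by omega
        simp [hy, h1]
      · simp [hy]
  have hleft : μ (cyl fun i : Fin (m + 1) => shiftMap x (i : ℕ)) = p * t := by
    rw [← hσ.measure_preimage (measurableSet_cyl _).nullMeasurableSet, ← hc.indegree (x 1)]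
    refine measure_eq_mul_of_fibers (measurable_pi_apply 0) _ (fun g hg => ?_) fun g hg => ?_
    · refine hnull _ fun z hz hzE => hg ?_
      have h1 : z 1 = x 1 := by simpa [shiftMap] using hz.2 0
      have h2 : z 0 = g := hz.1
      have h3 := hzE 0
      rwa [zero_add, h1, h2] at h3
    · obtain ⟨u, hu, s, rfl⟩ := hE g
      set y : ℤ → G := fun n => if n ≤ 0 then u (n + s) else x n with hy
      have hyE : y ∈ TMC E := mem_TMC_glue (mem_TMC_shift hu s) hx (by simpa using hg)
      rw [ht, hc.measure_cyl_eq_of_linked hμ hx hyE (hc.linked_of_linked_shift hirr hx hyE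
        (Linked.of_eq (by simp [hy, shiftMap])))]
      congr 1
      ext z
      refine Iff.trans ?_ (Fin.forall_fin_succ (P := fun i => z ((i : ℕ) : ℤ) = y (i : ℕ))).symm
      refine and_congr ?_ (forall_congr' fun i => ?_)
      · simp [hy]
      · have h1 : ¬ (((i : ℕ) : ℤ) + 1 ≤ 0) := by omega
        simp [hy, h1, shiftMap]
  rw [hleft, hright]

lemma IsCoord.measure_cyl_eq (hE : EveryLetterOccurs E) (hirr : IrreducibleTMC E)
    (hμ : ∀ v, MeasurePreserving (fun x => x + ι v) μ μ) (hσ : MeasurePreserving shiftMap μ μ)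
    (hμE : ∀ᵐ x ∂μ, x ∈ TMC E) {x y : ℤ → G} (hx : x ∈ TMC E) (hy : y ∈ TMC E) (m : ℕ) :
    μ (cyl fun i : Fin (m + 1) => x (i : ℕ)) = μ (cyl fun i : Fin (m + 1) => y (i : ℕ)) := by
  obtain ⟨k, -, hk⟩ := hc.exists_linked hirr hx y
  rw [← hc.measure_cyl_eq_of_linked hμ (mem_TMC_iterate hx k) hy hk]
  clear hk
  induction k with
  | zero => rfl
  | succ k ih =>
    rw [Function.iterate_succ_apply',
      hc.measure_cyl_shiftMap hE hirr hμ hσ hμE (mem_TMC_iterate hx k), ih]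

lemma IsCoord.card_mul_measure_cyl [IsProbabilityMeasure μ] (hE : EveryLetterOccurs E)
    (hirr : IrreducibleTMC E) (hμ : ∀ v, MeasurePreserving (fun x => x + ι v) μ μ)
    (hσ : MeasurePreserving shiftMap μ μ) (hμE : ∀ᵐ x ∂μ, x ∈ TMC E) {m : ℕ}
    {w : Fin (m + 1) → G} (hw : WordIn (TMC E) w) :
    ((Fintype.card G * p ^ m : ℕ) : ℝ≥0∞) * μ (cyl w) = 1 := by
  have hword : ∀ w : Fin (m + 1) → G, WordIn (TMC E) w →
      ∃ x ∈ TMC E, (fun i : Fin (m + 1) => x (i : ℕ)) = w := by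
    rintro w ⟨x, hx, j, h⟩
    exact ⟨_, mem_TMC_shift hx j, funext fun i => by rw [← h i, add_comm]⟩
  have hfib : ∀ g : Fin (m + 1) → G, window 0 (m + 1) ⁻¹' {g} = cyl g := fun g => by
    ext z
    refine Iff.trans funext_iff (forall_congr' fun i => ?_)
    rw [window, zero_add]
  rw [← ncard_words hE hc.outdegree m, ← measure_univ (μ := μ)]
  refine (measure_eq_mul_of_fibers (measurable_window 0 (m + 1)) _ (fun g hg => ?_)
    fun g hg => ?_).symm
  · rw [hfib]
    refine measure_mono_null (t := {z | z ∉ TMC E}) (fun z hz hzE => hg ?_) (ae_iff.1 hμE)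
    exact ⟨z, hzE, 0, fun i => by simpa using hz.1 i⟩
  · obtain ⟨x, hx, rfl⟩ := hword g hg
    obtain ⟨y, hy, rfl⟩ := hword w hw
    rw [hfib, Set.inter_univ, hc.measure_cyl_eq hE hirr hμ hσ hμE hx hy]

lemma IsCoord.isParryMeasure [IsProbabilityMeasure μ] (hE : EveryLetterOccurs E)
    (hirr : IrreducibleTMC E) (hμ : ∀ v, MeasurePreserving (fun x => x + ι v) μ μ)
    (hσ : MeasurePreserving shiftMap μ μ) (hμE : ∀ᵐ x ∂μ, x ∈ TMC E) : IsParryMeasure E μ := by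
  classical
  have hp : (0 : ℝ) < p := Nat.cast_pos.2 (Fact.out : p.Prime).pos
  have hG : (0 : ℝ) < Fintype.card G := Nat.cast_pos.2 Fintype.card_pos
  refine ⟨inferInstance, hσ.map_eq, p, fun _ => 1, fun _ => (Fintype.card G : ℝ)⁻¹, hp,
    fun _ => one_pos, fun _ => inv_pos.2 hG, fun g => ?_, fun g => ?_, ?_, fun m w hw => ?_⟩
  · rw [← hc.outdegree g, Set.ncard_eq_toFinset_card', mul_one]
    simp [Set.indicator_apply]
  · rw [← hc.indegree g, Set.ncard_eq_toFinset_card']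
    simp [Set.indicator_apply, Finset.sum_ite]
  · simp [hG.ne']
  · have h := congrArg ENNReal.toReal (hc.card_mul_measure_cyl hE hirr hμ hσ hμE hw)
    rw [ENNReal.toReal_mul, ENNReal.toReal_natCast, ENNReal.toReal_one] at h
    push_cast at h
    field_simp
    linarith

end Parry

end CAStmt

/-- Theorem: rigidity under `(Φ,σ)`-ergodicity, positive entropy of `Φ`,
and coincidence mod `μ` of the `σ^{(p-1)p}`-invariant and `σ`-invariant σ-algebras. -/
theorem CAStmt.stmt19 {G : Type} [Fintype G] [AddCommGroup G]
    [MeasurableSpace G] [MeasurableSingletonClass G]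
    (E : Set (G × G)) (hE : EveryLetterOccurs E) (hirr : IrreducibleTMC E)
    (φ : G → G → G) (hSC : SC E φ)
    (η ρa : G ≃+ G) (hcomm : ∀ a, η (ρa a) = ρa (η a)) (c : G)
    (hφ : ∀ a b, φ a b = η a + ρa b + c)
    (p : ℕ) (hp : p.Prime)
    (hent : Tendsto (fun m : ℕ => Real.log ({w : Fin m → G | WordIn (TMC E) w}.ncard) / m)
      atTop (nhds (Real.log p)))
    (μ : Measure (ℤ → G)) [IsProbabilityMeasure μ] (hμG : μ (TMC E) = 1)
    (hμΦ : Measure.map (CA φ) μ = μ) (hμσ : Measure.map shiftMap μ = μ)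
    (herg : ∀ s : Set (ℤ → G), MeasurableSet s →
      shiftMap ⁻¹' s = s → CA φ ⁻¹' s = s → μ s = 0 ∨ μ s = 1)
    (hpos : KSEntropyPos μ (CA φ))
    (hσalg : (∀ s : Set (ℤ → G), MeasurableSet s → shiftMap^[(p - 1) * p] ⁻¹' s = s →
        ∃ t : Set (ℤ → G), MeasurableSet t ∧ shiftMap ⁻¹' t = t ∧
          μ ((s \ t) ∪ (t \ s)) = 0) ∧
      (∀ t : Set (ℤ → G), MeasurableSet t → shiftMap ⁻¹' t = t →
        ∃ s : Set (ℤ → G), MeasurableSet s ∧ shiftMap^[(p - 1) * p] ⁻¹' s = s ∧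
          μ ((s \ t) ∪ (t \ s)) = 0)) :
    IsParryMeasure E μ := by
  let _ : TopologicalSpace G := ⊥
  have _ : DiscreteTopology G := ⟨rfl⟩
  have _ : Fact p.Prime := ⟨hp⟩
  have hσ : MeasurePreserving shiftMap μ μ := ⟨measurable_shiftMap, hμσ⟩
  have hΦ : MeasurePreserving (CA φ) μ μ := ⟨(continuous_CA φ).measurable, hμΦ⟩
  have hμE : ∀ᵐ x ∂μ, x ∈ TMC E := (prob_compl_eq_zero_iff (measurableSet_TMC E)).2 hμG
  obtain ⟨a, b, ι, ℓ, hc⟩ := exists_isCoord hE hSC η ρa c hφ hent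
  obtain ⟨δ, hδ, hinj⟩ := hpos.exists_le_of_injOn
    (fun a x y h => ρa.injective (by simpa [hφ] using h))
    (fun b x y h => η.injective (by simpa [hφ] using h)) hσ hΦ
  refine hc.isParryMeasure hE hirr
    (hc.measurePreserving_translate hirr hμE hσ hΦ herg hδ fun j => ?_) hσ hμE
  have hinv : ∀ s, MeasurableSet s → shiftMap^[(p - 1) * p] ⁻¹' s = s →
      shiftMap ⁻¹' s =ᵐ[μ] s := by
    intro s hs hss
    obtain ⟨t, -, htt, hst⟩ := hσalg.1 s hs hss
    have hae : s =ᵐ[μ] t :=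
      measure_symmDiff_eq_zero_iff.1 hst
    have h1 := hσ.quasiMeasurePreserving.preimage_ae_eq hae
    rw [htt] at h1
    exact h1.trans hae.symm
  have hp1 : 0 < p - 1 := Nat.sub_pos_of_lt hp.one_lt
  refine hc.exists_invariant_part hirr hμE hσ hΦ hinj (n := p ^ (j + 1))
    (N := (p - 1) * p ^ (j + 1)) (Nat.lt_pow_self hp.one_lt).le
    (fun d hd => iterate_shiftMap_of_mem_ker hc.a_ne hc.b_ne _ hd)
    fun s hs hss => preimage_ae_eq_of_iterate hσ.measurable
      (Nat.mul_pos hp1 (pow_pos hp.pos _)) (fun q hq hqd => ?_) hinv hs hss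
  rcases hq.dvd_mul.1 hqd with h | h
  · exact h.mul_right p
  · exact (hq.dvd_of_dvd_pow h).mul_left (p - 1)
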